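/- Let 1 < q < p < ∞ and let s be a real number with −(1 − 1/p) < s < −(1 − 1/q). There exists a constant c > 0 (depending only on p, q, s and φ₀) such that for every finite nonempty set A of nonnegative integers there exist a finite set E of Haar indices with HF(E) ⊆ A and a nonzero Schwartz function f : ℝ → ℂ with ‖P_E f‖_{F^s_{p,q}} ≥ c · (#A)^{−s−1+1/q} · ‖f‖_{F^s_{p,q}}. -/

import Mathlib

open MeasureTheory Real FourierTransform
open scoped ENNReal

noncomputable section

def haarFn (j : ℕ) (μ : ℤ) : ℝ → ℂ := fun x =>
  (Set.Ico ((2:ℝ)^(-(j:ℤ)) * μ) ((2:ℝ)^(-(j:ℤ)) * (μ + 1/2))).indicator (fun _ => (1:ℂ)) x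
  - (Set.Ico ((2:ℝ)^(-(j:ℤ)) * (μ + 1/2)) ((2:ℝ)^(-(j:ℤ)) * (μ + 1))).indicator (fun _ => (1:ℂ)) x

def haarProj (E : Finset (ℕ × ℤ)) (f : ℝ → ℂ) : ℝ → ℂ := fun x =>
  ∑ e ∈ E, (2:ℂ)^e.1 * (∫ y : ℝ, f y * haarFn e.1 e.2 y) * haarFn e.1 e.2 x

def HFset (E : Finset (ℕ × ℤ)) : Finset ℕ := E.image Prod.fst

def conv (f g : ℝ → ℂ) : ℝ → ℂ := fun x => ∫ t : ℝ, f t * g (x - t)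

def LPop (φ₀ : ℝ → ℂ) (k : ℕ) (g : ℝ → ℂ) : ℝ → ℂ :=
  if k = 0 then conv g (𝓕⁻ φ₀)
  else conv g (fun x => (2:ℂ)^k * (𝓕⁻ (fun ξ => φ₀ ξ - φ₀ (2*ξ))) ((2:ℝ)^k * x))

def FNorm (φ₀ : ℝ → ℂ) (p q s : ℝ) (g : ℝ → ℂ) : ℝ≥0∞ :=
  (∫⁻ x : ℝ, (∑' k : ℕ, ENNReal.ofReal ((2:ℝ)^((k:ℝ)*s*q)) *
      (ENNReal.ofReal ‖LPop φ₀ k g x‖)^q)^(p/q) ∂volume)^(1/p)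

lemma fourierInv_eq_integral_exp (f : ℝ → ℂ) (x : ℝ) :
    𝓕⁻ f x = ∫ ξ : ℝ, Complex.exp (2 * π * (ξ * x) * Complex.I) * f ξ := by
  rw [Real.fourierInv_eq']
  congr 1
  ext ξ
  simp [mul_comm x ξ]

lemma fourierInv_toSchwartzMap {a : ℝ → ℂ} (ha : ContDiff ℝ (⊤ : ℕ∞) a)
    (ha' : HasCompactSupport a) :
    (⇑(𝓕⁻ (ha'.toSchwartzMap ha) : SchwartzMap ℝ ℂ) : ℝ → ℂ) = 𝓕⁻ a := by
  rw [SchwartzMap.fourierInv_coe]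
  rfl

lemma contDiff_exp_mul_I (x : ℝ) :
    ContDiff ℝ (⊤ : ℕ∞) (fun ξ : ℝ => Complex.exp (2 * π * (ξ * x) * Complex.I)) := by
  have : ContDiff ℝ (⊤ : ℕ∞) (fun ξ : ℝ => (ξ : ℂ)) := Complex.ofRealCLM.contDiff
  fun_prop

/-- The convolution of two inverse Fourier transforms of test functions is the inverse Fourier
transform of their product. -/
lemma conv_fourierInv {a m : ℝ → ℂ} (ha : ContDiff ℝ (⊤ : ℕ∞) a) (ha' : HasCompactSupport a)
    (hm : ContDiff ℝ (⊤ : ℕ∞) m) (hm' : HasCompactSupport m) (x : ℝ) :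
    conv (𝓕⁻ a) (𝓕⁻ m) x = 𝓕⁻ (fun ξ => a ξ * m ξ) x := by
  have he := (contDiff_exp_mul_I x).mul hm
  have he' : HasCompactSupport (fun ξ : ℝ => Complex.exp (2 * π * (ξ * x) * Complex.I) * m ξ) :=
    hm'.mul_left
  set M := he'.toSchwartzMap he
  have hFM : ∀ t, 𝓕⁻ m (x - t) = (𝓕 M) t := by
    intro t
    rw [SchwartzMap.fourier_coe, Real.fourier_eq', fourierInv_eq_integral_exp]
    congr 1
    ext ξ
    change _ = _ • (Complex.exp (2 * π * (ξ * x) * Complex.I) * m ξ)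
    rw [smul_eq_mul, ← mul_assoc (Complex.exp _) (Complex.exp _), ← Complex.exp_add]
    congr 2
    simp
    ring
  have h := SchwartzMap.integral_fourierInv_mul_eq (ha'.toSchwartzMap ha) (𝓕 M)
  rw [FourierTransform.fourierInv_fourier_eq, fourierInv_toSchwartzMap] at h
  unfold conv
  simp_rw [hFM]
  rw [h, fourierInv_eq_integral_exp]
  congr 1
  ext ξ
  change a ξ * (Complex.exp (2 * π * (ξ * x) * Complex.I) * m ξ) = _
  ring

lemma fourierInv_comp_neg (m : ℝ → ℂ) (x : ℝ) :
    𝓕⁻ (fun ξ => m (-ξ)) x = 𝓕⁻ m (-x) := by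
  rw [fourierInv_eq_integral_exp, fourierInv_eq_integral_exp,
    ← integral_neg_eq_self (fun ξ : ℝ => Complex.exp (2 * π * (ξ * (-x : ℝ)) * Complex.I) * m ξ)]
  simp

lemma fourierInv_comp_mul (m : ℝ → ℂ) {c : ℝ} (hc : 0 < c) (x : ℝ) :
    𝓕⁻ (fun ξ => m (c⁻¹ * ξ)) x = c * 𝓕⁻ m (c * x) := by
  rw [fourierInv_eq_integral_exp, fourierInv_eq_integral_exp]
  have h := Measure.integral_comp_mul_left
    (fun ξ : ℝ => Complex.exp (2 * π * (ξ * (c * x : ℝ)) * Complex.I) * m ξ) c⁻¹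
  rw [inv_inv, abs_of_pos hc, Complex.real_smul] at h
  rw [← h]
  congr 1
  ext ξ
  have : (c : ℂ) ≠ 0 := by exact_mod_cast hc.ne'
  congr 3
  push_cast
  field_simp

/-- The frequency symbol of the `k`-th Littlewood-Paley operator. -/
def lpSymbol (φ₀ : ℝ → ℂ) (k : ℕ) : ℝ → ℂ :=
  if k = 0 then φ₀ else fun ξ => φ₀ (((2:ℝ)^k)⁻¹ * ξ) - φ₀ (2 * (((2:ℝ)^k)⁻¹ * ξ))

lemma LPop_eq (φ₀ : ℝ → ℂ) (k : ℕ) (g : ℝ → ℂ) :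
    LPop φ₀ k g = conv g (𝓕⁻ (lpSymbol φ₀ k)) := by
  unfold LPop lpSymbol
  split_ifs with hk
  · rfl
  · congr 1
    ext x
    rw [fourierInv_comp_mul (fun ξ => φ₀ ξ - φ₀ (2*ξ)) (by positivity)]
    push_cast
    rfl

lemma contDiff_lpSymbol {φ₀ : ℝ → ℂ} (h : ContDiff ℝ (⊤ : ℕ∞) φ₀) (k : ℕ) :
    ContDiff ℝ (⊤ : ℕ∞) (lpSymbol φ₀ k) := by
  unfold lpSymbol
  split_ifs
  · exact h
  · fun_prop

lemma hasCompactSupport_comp_mul {φ : ℝ → ℂ} (h : HasCompactSupport φ) {c : ℝ} (hc : c ≠ 0) :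
    HasCompactSupport (fun ξ => φ (c * ξ)) :=
  h.comp_homeomorph (Homeomorph.mulLeft₀ c hc)

lemma hasCompactSupport_lpSymbol {φ₀ : ℝ → ℂ} (h : HasCompactSupport φ₀) (k : ℕ) :
    HasCompactSupport (lpSymbol φ₀ k) := by
  unfold lpSymbol
  split_ifs
  · exact h
  · have h1 := hasCompactSupport_comp_mul h (c := ((2:ℝ)^k)⁻¹) (by positivity)
    have h2 := hasCompactSupport_comp_mul h (c := 2 * ((2:ℝ)^k)⁻¹) (by positivity)
    simp_rw [mul_assoc] at h2
    exact h1.sub h2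

/-- The symbol equals one near the dyadic frequencies `± 2 ^ k`. -/
lemma lpSymbol_eq_one {φ₀ : ℝ → ℂ} (hφone : ∀ ξ : ℝ, |ξ| ≤ 4/3 → φ₀ ξ = 1)
    (hφzero : ∀ ξ : ℝ, 3/2 ≤ |ξ| → φ₀ ξ = 0) (k : ℕ) {ξ : ℝ}
    (h1 : 9/10 * (2:ℝ)^k ≤ |ξ|) (h2 : |ξ| ≤ 11/10 * (2:ℝ)^k) : lpSymbol φ₀ k ξ = 1 := by
  unfold lpSymbol
  split_ifs with hk
  · subst hk
    exact hφone _ (by norm_num at h2; linarith)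
  · have hp : (0:ℝ) < 2^k := by positivity
    have ha : |((2:ℝ)^k)⁻¹ * ξ| = |ξ| / 2^k := by
      rw [abs_mul, abs_of_pos (inv_pos.2 hp)]; ring
    have hb : |2 * (((2:ℝ)^k)⁻¹ * ξ)| = 2 * (|ξ| / 2^k) := by
      rw [abs_mul, ha, abs_of_pos (by norm_num : (0:ℝ) < 2)]
    have e1 : 9/10 ≤ |ξ| / 2^k := by rwa [le_div_iff₀ hp]
    have e2 : |ξ| / 2^k ≤ 11/10 := by rwa [div_le_iff₀ hp]
    change φ₀ _ - φ₀ _ = 1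
    rw [hφone _ (by rw [ha]; linarith), hφzero _ (by rw [hb]; linarith), sub_zero]

/-- The symbol vanishes near all other dyadic frequencies. -/
lemma lpSymbol_eq_zero {φ₀ : ℝ → ℂ} (hφone : ∀ ξ : ℝ, |ξ| ≤ 4/3 → φ₀ ξ = 1)
    (hφzero : ∀ ξ : ℝ, 3/2 ≤ |ξ| → φ₀ ξ = 0) {k n : ℕ} (hkn : k ≠ n) {ξ : ℝ}
    (h1 : 9/10 * (2:ℝ)^n ≤ |ξ|) (h2 : |ξ| ≤ 11/10 * (2:ℝ)^n) : lpSymbol φ₀ k ξ = 0 := by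
  have hp : (0:ℝ) < 2^k := by positivity
  have hn : (0:ℝ) < 2^n := by positivity
  have ha : |((2:ℝ)^k)⁻¹ * ξ| = |ξ| / 2^k := by
    rw [abs_mul, abs_of_pos (inv_pos.2 hp)]; ring
  have hb : |2 * (((2:ℝ)^k)⁻¹ * ξ)| = 2 * (|ξ| / 2^k) := by
    rw [abs_mul, ha, abs_of_pos (by norm_num : (0:ℝ) < 2)]
  rcases lt_or_gt_of_ne hkn with h | h
  · have e : (2:ℝ)^k * 2 ≤ 2^n := by
      rw [← pow_succ]; exact pow_le_pow_right₀ (by norm_num) h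
    have e1 : 9/5 ≤ |ξ| / 2^k := by
      rw [le_div_iff₀ hp]; linarith
    unfold lpSymbol
    split_ifs with hk
    · subst hk
      exact hφzero _ (by norm_num at e1; linarith)
    · change φ₀ _ - φ₀ _ = 0
      rw [hφzero _ (by rw [ha]; linarith), hφzero _ (by rw [hb]; linarith), sub_zero]
  · have e : (2:ℝ)^n * 2 ≤ 2^k := by
      rw [← pow_succ]; exact pow_le_pow_right₀ (by norm_num) h
    have e1 : |ξ| / 2^k ≤ 11/20 := by
      rw [div_le_iff₀ hp]; linarith
    unfold lpSymbol
    rw [if_neg (by omega)]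
    change φ₀ _ - φ₀ _ = 0
    rw [hφone _ (by rw [ha]; linarith), hφone _ (by rw [hb]; linarith), sub_self]

lemma LPop_fourierInv {φ₀ : ℝ → ℂ} (hφsmooth : ContDiff ℝ (⊤ : ℕ∞) φ₀)
    (hφcpt : HasCompactSupport φ₀) (hφone : ∀ ξ : ℝ, |ξ| ≤ 4/3 → φ₀ ξ = 1)
    (hφzero : ∀ ξ : ℝ, 3/2 ≤ |ξ| → φ₀ ξ = 0) {a : ℝ → ℂ} (ha : ContDiff ℝ (⊤ : ℕ∞) a)
    (ha' : HasCompactSupport a) {n : ℕ}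
    (hsupp : ∀ ξ, a ξ ≠ 0 → 9/10 * (2:ℝ)^n ≤ |ξ| ∧ |ξ| ≤ 11/10 * (2:ℝ)^n) (l : ℕ) (x : ℝ) :
    LPop φ₀ l (𝓕⁻ a) x = if l = n then 𝓕⁻ a x else 0 := by
  rw [LPop_eq, conv_fourierInv ha ha' (contDiff_lpSymbol hφsmooth l)
    (hasCompactSupport_lpSymbol hφcpt l)]
  have key : (fun ξ => a ξ * lpSymbol φ₀ l ξ) = fun ξ => if l = n then a ξ else 0 := by
    ext ξ
    by_cases h0 : a ξ = 0
    · simp [h0]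
    · obtain ⟨h1, h2⟩ := hsupp ξ h0
      split_ifs with h
      · subst h
        rw [lpSymbol_eq_one hφone hφzero l h1 h2, mul_one]
      · rw [lpSymbol_eq_zero hφone hφzero h h1 h2, mul_zero]
  rw [key]
  split_ifs
  · rfl
  · rw [fourierInv_eq_integral_exp]; simp

/-- Littlewood-Paley operators reproduce pairings with functions of frequency about `2 ^ k`. -/
lemma integral_LPop_mul {φ₀ : ℝ → ℂ} (hφsmooth : ContDiff ℝ (⊤ : ℕ∞) φ₀)
    (hφcpt : HasCompactSupport φ₀) (hφone : ∀ ξ : ℝ, |ξ| ≤ 4/3 → φ₀ ξ = 1)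
    (hφzero : ∀ ξ : ℝ, 3/2 ≤ |ξ| → φ₀ ξ = 0) {a : ℝ → ℂ} (ha : ContDiff ℝ (⊤ : ℕ∞) a)
    (ha' : HasCompactSupport a) {k : ℕ}
    (hsupp : ∀ ξ, a ξ ≠ 0 → 9/10 * (2:ℝ)^k ≤ |ξ| ∧ |ξ| ≤ 11/10 * (2:ℝ)^k)
    {g : ℝ → ℂ} (hg : Integrable g) :
    ∫ x, LPop φ₀ k g x * 𝓕⁻ a x = ∫ x, g x * 𝓕⁻ a x := by
  have hm := contDiff_lpSymbol hφsmooth k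
  have hm' := hasCompactSupport_lpSymbol hφcpt k
  have hneg : ContDiff ℝ (⊤ : ℕ∞) (fun ξ => lpSymbol φ₀ k (-ξ)) := hm.comp contDiff_neg
  have hneg' : HasCompactSupport (fun ξ => lpSymbol φ₀ k (-ξ)) :=
    hm'.comp_homeomorph (Homeomorph.neg ℝ)
  have hrep : ∀ t, ∫ x, 𝓕⁻ (lpSymbol φ₀ k) (x - t) * 𝓕⁻ a x = 𝓕⁻ a t := by
    intro t
    have h := conv_fourierInv ha ha' hneg hneg' t
    unfold conv at h
    simp_rw [fourierInv_comp_neg, neg_sub] at h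
    simp_rw [mul_comm (𝓕⁻ (lpSymbol φ₀ k) _)]
    rw [h]
    refine congrFun (congrArg _ (funext fun ξ => ?_)) t
    by_cases h0 : a ξ = 0
    · simp [h0]
    · obtain ⟨h1, h2⟩ := hsupp ξ h0
      rw [lpSymbol_eq_one hφone hφzero k (by rwa [abs_neg]) (by rwa [abs_neg]), mul_one]
  set Φ : SchwartzMap ℝ ℂ := 𝓕⁻ (hm'.toSchwartzMap hm)
  set Ψ : SchwartzMap ℝ ℂ := 𝓕⁻ (ha'.toSchwartzMap ha)
  have eΦ : (⇑Φ : ℝ → ℂ) = 𝓕⁻ (lpSymbol φ₀ k) := fourierInv_toSchwartzMap hm hm'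
  have eΨ : (⇑Ψ : ℝ → ℂ) = 𝓕⁻ a := fourierInv_toSchwartzMap ha ha'
  rw [LPop_eq, ← eΦ, ← eΨ]
  rw [← eΦ, ← eΨ] at hrep
  unfold conv
  obtain ⟨C, -, hC⟩ := Φ.decay 0 0
  simp only [pow_zero, one_mul, norm_iteratedFDeriv_zero] at hC
  have hint : Integrable (fun z : ℝ × ℝ => g z.2 * Φ (z.1 - z.2) * Ψ z.1)
      (volume.prod volume) := by
    have h1 : Integrable (fun z : ℝ × ℝ => Ψ z.1 * g z.2) (volume.prod volume) :=
      (Ψ.integrable (μ := volume)).mul_prod hg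
    have h2 := h1.bdd_mul (c := C) (f := fun z : ℝ × ℝ => Φ (z.1 - z.2))
      (by
        have := Φ.continuous
        exact (by fun_prop : Continuous fun z : ℝ × ℝ => Φ (z.1 - z.2)).aestronglyMeasurable)
      (Filter.Eventually.of_forall fun z => hC _)
    refine h2.congr (Filter.Eventually.of_forall fun z => ?_)
    simp only
    ring
  simp_rw [← integral_mul_const]
  rw [integral_integral_swap hint]
  congr 1
  ext t
  simp_rw [mul_assoc]
  rw [integral_const_mul, hrep]

lemma exists_signs_sum_diag_le {ι : Type*} [DecidableEq ι] (J : Finset ι) (Q : ι → ι → ℝ) :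
    ∃ v : ι → ℝ, (∀ i, v i = 1 ∨ v i = -1) ∧
      ∑ i ∈ J, Q i i ≤ ∑ i ∈ J, ∑ j ∈ J, v i * v j * Q i j := by
  induction J using Finset.induction_on with
  | empty => exact ⟨fun _ => 1, fun _ => Or.inl rfl, by simp⟩
  | insert a J ha ih =>
    obtain ⟨v, hv, hle⟩ := ih
    set X := ∑ j ∈ J, v j * (Q a j + Q j a) with hX
    obtain ⟨t, ht, htX⟩ : ∃ t : ℝ, (t = 1 ∨ t = -1) ∧ 0 ≤ t * X := by
      rcases le_total 0 X with h | h
      · exact ⟨1, Or.inl rfl, by simpa using h⟩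
      · exact ⟨-1, Or.inr rfl, by simpa using h⟩
    refine ⟨Function.update v a t, fun i => ?_, ?_⟩
    · by_cases hi : i = a
      · subst hi; simpa using ht
      · simpa [hi] using hv i
    · have hne : ∀ i ∈ J, Function.update v a t i = v i := fun i hi =>
        Function.update_of_ne (fun h : i = a => ha (h ▸ hi)) _ _
      have htt : t * t = 1 := by rcases ht with h | h <;> simp [h]
      have hrow : ∑ j ∈ J, t * Function.update v a t j * Q a j = t * ∑ j ∈ J, v j * Q a j := by
        rw [Finset.mul_sum]
        exact Finset.sum_congr rfl fun j hj => by rw [hne j hj]; ring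
      have hrest : ∑ i ∈ J, ∑ j ∈ insert a J,
          Function.update v a t i * Function.update v a t j * Q i j =
          t * (∑ i ∈ J, v i * Q i a) + ∑ i ∈ J, ∑ j ∈ J, v i * v j * Q i j := by
        rw [Finset.mul_sum, ← Finset.sum_add_distrib]
        refine Finset.sum_congr rfl fun i hi => ?_
        rw [Finset.sum_insert ha, hne i hi, Function.update_self]
        congr 1
        · ring
        · exact Finset.sum_congr rfl fun j hj => by rw [hne j hj]
      rw [Finset.sum_insert ha, Finset.sum_insert ha, Finset.sum_insert ha, hrest,
        Function.update_self, hrow, htt]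
      have hXe : t * X = t * (∑ j ∈ J, v j * Q a j) + t * ∑ i ∈ J, v i * Q i a := by
        rw [hX, ← mul_add, ← Finset.sum_add_distrib]
        congr 1
        exact Finset.sum_congr rfl fun j _ => by ring
      linarith

/-- A polynomially decaying weight. -/
def decayWeight (y : ℝ) : ℝ := ((1 + |y|) ^ 2)⁻¹

lemma decayWeight_pos (y : ℝ) : 0 < decayWeight y := by unfold decayWeight; positivity

lemma decayWeight_le_one (y : ℝ) : decayWeight y ≤ 1 := by
  unfold decayWeight
  exact inv_le_one_of_one_le₀ (one_le_pow₀ (by linarith [abs_nonneg y]))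

lemma decayWeight_mul_le {b c : ℝ} (hb : 0 ≤ b) (hbc : b ≤ c) (x y m : ℝ) :
    decayWeight (b * (x - m)) * decayWeight (c * (x - y)) ≤ decayWeight (b * (y - m)) := by
  unfold decayWeight
  rw [← mul_inv, ← mul_pow]
  refine inv_anti₀ (by positivity) ?_
  gcongr
  simp only [abs_mul, abs_of_nonneg hb, abs_of_nonneg (hb.trans hbc)]
  have h1 : |y - m| ≤ |x - m| + |x - y| := by
    rw [abs_sub_comm x y, add_comm]; exact abs_sub_le _ _ _
  have h2 : b * |x - y| ≤ c * |x - y| := by gcongr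
  have h3 : b * |y - m| ≤ b * (|x - m| + |x - y|) := by gcongr
  have h4 : 0 ≤ b * |x - m| * (c * |x - y|) := by
    have := hb.trans hbc
    positivity
  nlinarith

lemma decayWeight_le_increment {a : ℝ} (ha : 0 < a) (t : ℝ) :
    decayWeight (a * t) ≤
      ((t + 1) / (1 + a * |t + 1|) + if 0 < t + 1 then 1 else 0)
        - ((t - 1) / (1 + a * |t - 1|) + if 0 < t - 1 then 1 else 0) := by
  have hmono : ∀ u v : ℝ, u ≤ v → u / (1 + a * |u|) ≤ v / (1 + a * |v|) := by
    intro u v huv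
    rw [div_le_div_iff₀ (by positivity) (by positivity)]
    rcases le_total 0 u with hu | hu
    · rw [abs_of_nonneg hu, abs_of_nonneg (hu.trans huv)]; nlinarith
    · rcases le_total 0 v with hv | hv
      · have h1 : 0 ≤ v * (1 + a * |u|) := by positivity
        have h2 : u * (1 + a * |v|) ≤ 0 := mul_nonpos_of_nonpos_of_nonneg hu (by positivity)
        linarith
      · rw [abs_of_nonpos hu, abs_of_nonpos hv]; nlinarith
  rcases le_or_gt 1 t with h1 | h1
  · have e := hmono t (t + 1) (by linarith)
    have e2 : decayWeight (a * t) ≤ t / (1 + a * |t|) - (t - 1) / (1 + a * |t - 1|) := by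
      unfold decayWeight
      rw [abs_mul, abs_of_pos ha, abs_of_nonneg (by linarith : 0 ≤ t),
        abs_of_nonneg (by linarith : 0 ≤ t - 1)]
      have p1 : 0 < 1 + a * t := by nlinarith
      have p2 : 0 < 1 + a * (t - 1) := by nlinarith
      have : t / (1 + a * t) - (t - 1) / (1 + a * (t - 1))
          = ((1 + a * t) * (1 + a * (t - 1)))⁻¹ := by
        field_simp; ring
      rw [this]
      refine inv_anti₀ (by positivity) ?_
      rw [sq]
      gcongr
      linarith
    have e3 : (if 0 < t - 1 then (1:ℝ) else 0) ≤ if 0 < t + 1 then 1 else 0 := by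
      rw [if_pos (by linarith : 0 < t + 1)]; split_ifs <;> norm_num
    linarith
  · rcases le_or_gt t (-1) with h2 | h2
    · have e := hmono (t - 1) t (by linarith)
      have e2 : decayWeight (a * t) ≤ (t + 1) / (1 + a * |t + 1|) - t / (1 + a * |t|) := by
        unfold decayWeight
        rw [abs_mul, abs_of_pos ha, abs_of_nonpos (by linarith : t ≤ 0),
          abs_of_nonpos (by linarith : t + 1 ≤ 0)]
        have p1 : 0 < 1 + a * -t := by nlinarith
        have p2 : 0 < 1 + a * -(t + 1) := by nlinarith
        have : (t + 1) / (1 + a * -(t + 1)) - t / (1 + a * -t)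
            = ((1 + a * -t) * (1 + a * -(t + 1)))⁻¹ := by
          rw [div_sub_div _ _ p2.ne' p1.ne', inv_eq_one_div,
            div_eq_div_iff (by positivity) (by positivity)]
          ring
        rw [this]
        refine inv_anti₀ (by positivity) ?_
        rw [sq]
        gcongr
        linarith
      have e3 : (if 0 < t - 1 then (1:ℝ) else 0) ≤ if 0 < t + 1 then 1 else 0 := by
        rw [if_neg (by linarith : ¬ 0 < t - 1)]; split_ifs <;> norm_num
      linarith
    · rw [if_pos (by linarith : 0 < t + 1), if_neg (by linarith : ¬ 0 < t - 1)]
      have := decayWeight_le_one (a * t)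
      have := hmono (t - 1) (t + 1) (by linarith)
      linarith

lemma sum_decayWeight_le {a : ℝ} (ha : 0 < a) (b : ℝ) (n : ℕ) :
    ∑ μ ∈ Finset.range n, decayWeight (a * (μ - b)) ≤ 4 * (1 + 1 / a) := by
  set P : ℝ → ℝ := fun t => t / (1 + a * |t|) + if 0 < t then 1 else 0 with hP
  have hbound : ∀ t, -(1 / a) ≤ P t ∧ P t ≤ 1 / a + 1 := by
    intro t
    have h : |t / (1 + a * |t|)| ≤ 1 / a := by
      rw [abs_div, abs_of_pos (by positivity : 0 < 1 + a * |t|),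
        div_le_div_iff₀ (by positivity) ha]
      linarith
    rw [abs_le] at h
    constructor <;> simp only [hP] <;> split_ifs <;> linarith
  have h1 := Finset.sum_range_sub (fun μ : ℕ => P (μ - b)) n
  have h2 := Finset.sum_range_sub (fun μ : ℕ => P (μ - b - 1)) n
  calc ∑ μ ∈ Finset.range n, decayWeight (a * (μ - b))
      ≤ ∑ μ ∈ Finset.range n, ((P ((μ + 1 : ℕ) - b) - P (μ - b))
          + (P ((μ + 1 : ℕ) - b - 1) - P (μ - b - 1))) := by
        refine Finset.sum_le_sum fun μ _ => ?_
        refine (decayWeight_le_increment ha (μ - b)).trans_eq ?_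
        have e1 : ((μ + 1 : ℕ) : ℝ) - b = μ - b + 1 := by push_cast; ring
        have e2 : (μ : ℝ) - b + 1 - 1 = μ - b := by ring
        rw [e1, e2]
        simp only [hP]
        ring
    _ = (P (n - b) - P ((0:ℕ) - b)) + (P (n - b - 1) - P ((0:ℕ) - b - 1)) := by
        rw [Finset.sum_add_distrib, h1, h2]
    _ ≤ 4 * (1 + 1 / a) := by
        have := hbound (n - b)
        have := hbound ((0:ℕ) - b)
        have := hbound (n - b - 1)
        have := hbound ((0:ℕ) - b - 1)
        have : 0 < 1 / a := by positivity
        linarith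

/-- The midpoint of the dyadic interval of length `2 ^ (-k)` with index `μ`. -/
def dyadicMid (k μ : ℕ) : ℝ := ((2:ℝ)^k)⁻¹ * (μ + 1/2)

lemma sum_decayWeight_dyadicMid_le (k m : ℕ) (y : ℝ) :
    ∑ μ ∈ Finset.range (2^k), decayWeight ((2:ℝ)^m * (y - dyadicMid k μ)) ≤
      4 * (1 + (2:ℝ)^k / 2^m) := by
  have hp : (0:ℝ) < 2^m / 2^k := by positivity
  have h := sum_decayWeight_le hp ((2:ℝ)^k * y - 1/2) (2^k)
  rw [one_div_div] at h
  refine (Finset.sum_congr rfl fun μ _ => ?_).trans_le h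
  unfold decayWeight dyadicMid
  rw [abs_mul, abs_mul, abs_of_pos hp, abs_of_pos (by positivity : (0:ℝ) < 2^m), abs_sub_comm]
  have : ((2:ℝ)^k)⁻¹ * (μ + 1/2) - y = ((2:ℝ)^k)⁻¹ * (μ - ((2:ℝ)^k * y - 1/2)) := by
    field_simp
    ring
  rw [this, abs_mul, abs_of_pos (by positivity : (0:ℝ) < ((2:ℝ)^k)⁻¹)]
  ring

/-- Total weight accumulated before generation `k`, where at each generation in `A` only those
midpoints are kept at which the weight accumulated so far is at most `16`. -/
def accumWeight (A : Finset ℕ) (ℓ : ℕ) : ℕ → ℝ → ℝ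
  | 0 => fun _ => 0
  | k + 1 => fun x => accumWeight A ℓ k x +
      if k ∈ A then
        ∑ μ ∈ (Finset.range (2^k)).filter (fun μ => accumWeight A ℓ k (dyadicMid k μ) ≤ 16),
          decayWeight ((2:ℝ)^(k+ℓ) * (x - dyadicMid k μ))
      else 0

/-- The midpoints kept at generation `k`. -/
def keptMids (A : Finset ℕ) (ℓ k : ℕ) : Finset ℕ :=
  (Finset.range (2^k)).filter (fun μ => accumWeight A ℓ k (dyadicMid k μ) ≤ 16)

lemma accumWeight_succ (A : Finset ℕ) (ℓ k : ℕ) (x : ℝ) :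
    accumWeight A ℓ (k + 1) x = accumWeight A ℓ k x +
      if k ∈ A then ∑ μ ∈ keptMids A ℓ k, decayWeight ((2:ℝ)^(k+ℓ) * (x - dyadicMid k μ))
      else 0 := rfl

lemma accumWeight_nonneg (A : Finset ℕ) (ℓ k : ℕ) (x : ℝ) : 0 ≤ accumWeight A ℓ k x := by
  induction k with
  | zero => exact le_rfl
  | succ k ih =>
    rw [accumWeight_succ]
    refine add_nonneg ih ?_
    split_ifs
    · exact Finset.sum_nonneg fun _ _ => (decayWeight_pos _).le
    · exact le_rfl

lemma accumWeight_mul_decayWeight_le (A : Finset ℕ) (ℓ k : ℕ) (x y : ℝ) {c : ℝ}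
    (hc : (2:ℝ)^(k+ℓ) ≤ c) :
    accumWeight A ℓ k x * decayWeight (c * (x - y)) ≤ accumWeight A ℓ k y := by
  induction k with
  | zero => simp [accumWeight]
  | succ k ih =>
    have hc' : (2:ℝ)^(k+ℓ) ≤ c :=
      (pow_le_pow_right₀ (by norm_num) (by omega)).trans hc
    rw [accumWeight_succ, accumWeight_succ, add_mul]
    refine add_le_add (ih hc') ?_
    split_ifs
    · rw [Finset.sum_mul]
      exact Finset.sum_le_sum fun μ _ => decayWeight_mul_le (by positivity) hc' _ _ _
    · simp

lemma accumWeight_le (A : Finset ℕ) (ℓ k : ℕ) (x : ℝ) :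
    accumWeight A ℓ k x ≤ ∑ j ∈ Finset.range k, if j ∈ A then
      ∑ μ ∈ Finset.range (2^j), decayWeight ((2:ℝ)^(j+ℓ) * (x - dyadicMid j μ)) else 0 := by
  induction k with
  | zero => simp [accumWeight]
  | succ k ih =>
    rw [accumWeight_succ, Finset.sum_range_succ]
    refine add_le_add ih ?_
    split_ifs
    · exact Finset.sum_le_sum_of_subset_of_nonneg (Finset.filter_subset _ _)
        fun _ _ _ => (decayWeight_pos _).le
    · exact le_rfl

lemma sum_accumWeight_dyadicMid_le {A : Finset ℕ} {ℓ : ℕ} (hA : A.card ≤ 2^ℓ) (k : ℕ) :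
    ∑ μ ∈ Finset.range (2^k), accumWeight A ℓ k (dyadicMid k μ) ≤ 8 * 2^k := by
  have hterm : ∀ j ∈ Finset.range k, ∑ μ ∈ Finset.range (2^k), (if j ∈ A then
      ∑ ν ∈ Finset.range (2^j), decayWeight ((2:ℝ)^(j+ℓ) * (dyadicMid k μ - dyadicMid j ν))
        else 0) ≤ 4 * 2^j + 4 * 2^k / 2^ℓ * (if j ∈ A then 1 else 0) := by
    intro j _
    split_ifs
    · rw [Finset.sum_comm]
      have : ∀ ν ∈ Finset.range (2^j), ∑ μ ∈ Finset.range (2^k),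
          decayWeight ((2:ℝ)^(j+ℓ) * (dyadicMid k μ - dyadicMid j ν)) ≤
          4 * (1 + (2:ℝ)^k / 2^(j+ℓ)) := by
        intro ν _
        refine (Finset.sum_congr rfl fun μ _ => ?_).trans_le
          (sum_decayWeight_dyadicMid_le k (j+ℓ) (dyadicMid j ν))
        unfold decayWeight
        rw [abs_mul, abs_mul, abs_sub_comm]
      refine (Finset.sum_le_sum this).trans_eq ?_
      rw [Finset.sum_const, Finset.card_range, nsmul_eq_mul]
      push_cast
      rw [pow_add]
      field_simp
    · simp
  calc ∑ μ ∈ Finset.range (2^k), accumWeight A ℓ k (dyadicMid k μ)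
      ≤ ∑ μ ∈ Finset.range (2^k), ∑ j ∈ Finset.range k, (if j ∈ A then
      ∑ ν ∈ Finset.range (2^j), decayWeight ((2:ℝ)^(j+ℓ) * (dyadicMid k μ - dyadicMid j ν))
        else 0) := Finset.sum_le_sum fun μ _ => accumWeight_le A ℓ k _
    _ ≤ ∑ j ∈ Finset.range k, (4 * 2^j + 4 * 2^k / 2^ℓ * (if j ∈ A then (1:ℝ) else 0)) := by
        rw [Finset.sum_comm]
        exact Finset.sum_le_sum hterm
    _ ≤ 4 * 2^k + 4 * 2^k / 2^ℓ * 2^ℓ := by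
        rw [Finset.sum_add_distrib, ← Finset.mul_sum, ← Finset.mul_sum]
        gcongr
        · have h := geom_sum_eq (by norm_num : (2:ℝ) ≠ 1) k
          rw [h]
          norm_num
        · rw [Finset.sum_ite_mem, Finset.sum_const, nsmul_eq_mul, mul_one]
          have : (Finset.range k ∩ A).card ≤ 2^ℓ :=
            (Finset.card_le_card Finset.inter_subset_right).trans hA
          exact_mod_cast this
    _ = 8 * 2^k := by
        have : (2:ℝ)^ℓ ≠ 0 := by positivity
        field_simp
        norm_num

lemma two_pow_le_two_mul_card_keptMids {A : Finset ℕ} {ℓ : ℕ} (hA : A.card ≤ 2^ℓ) (k : ℕ) :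
    (2:ℝ)^k ≤ 2 * (keptMids A ℓ k).card := by
  have h := sum_accumWeight_dyadicMid_le hA k
  have hsplit := Finset.card_filter_add_card_filter_not (s := Finset.range (2^k))
    (fun μ => accumWeight A ℓ k (dyadicMid k μ) ≤ 16)
  rw [Finset.card_range] at hsplit
  set R := (Finset.range (2^k)).filter (fun μ => ¬ accumWeight A ℓ k (dyadicMid k μ) ≤ 16)
  have hR : 16 * (R.card : ℝ) ≤ 8 * 2^k := by
    calc 16 * (R.card : ℝ) = ∑ μ ∈ R, (16:ℝ) := by rw [Finset.sum_const, nsmul_eq_mul, mul_comm]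
      _ ≤ ∑ μ ∈ R, accumWeight A ℓ k (dyadicMid k μ) :=
        Finset.sum_le_sum fun μ hμ => (not_le.1 (Finset.mem_filter.1 hμ).2).le
      _ ≤ _ := (Finset.sum_le_sum_of_subset_of_nonneg (Finset.filter_subset _ _)
        fun _ _ _ => accumWeight_nonneg _ _ _ _).trans h
  have hs : ((keptMids A ℓ k).card : ℝ) + R.card = 2^k := by
    have : (keptMids A ℓ k).card + R.card = 2^k := hsplit
    exact_mod_cast this
  linarith

lemma sq_mul_weight_le {g t v : ℝ} (g0 : 0 ≤ g) (g1 : g ≤ 1) (ht : 0 ≤ t) (hv : v ≤ 16)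
    (htg : t * g ≤ 16) : g^2 * ((t + 16) * (t + v + 16)) ≤ 1536 := by
  have e1 : g^2 * ((t + 16) * (t + v + 16)) ≤ g^2 * ((t + 16) * (t + 32)) := by
    have : t + v + 16 ≤ t + 32 := by linarith
    gcongr
  have e2 : g^2 * ((t + 16) * (t + 32)) = (t * g)^2 + 48 * (t * g * g) + 512 * g^2 := by ring
  have e3 : (t * g)^2 ≤ 16^2 := by gcongr
  have e4 : t * g * g ≤ 16 * 1 := by gcongr
  have e5 : g^2 ≤ 1^2 := by gcongr
  linarith

lemma sum_cube_le_sub {S : Finset ℕ} {g : ℕ → ℝ} {t : ℝ} (ht : 0 ≤ t)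
    (g0 : ∀ μ ∈ S, 0 ≤ g μ) (g1 : ∀ μ ∈ S, g μ ≤ 1) (htg : ∀ μ ∈ S, t * g μ ≤ 16)
    (hv : ∑ μ ∈ S, g μ ≤ 16) :
    ∑ μ ∈ S, g μ ^ 3 ≤ 1536 / (t + 16) - 1536 / (t + ∑ μ ∈ S, g μ + 16) := by
  have hv0 : 0 ≤ ∑ μ ∈ S, g μ := Finset.sum_nonneg g0
  generalize hw : ∑ μ ∈ S, g μ = v at hv hv0 ⊢
  have hid : 1536 / (t + 16) - 1536 / (t + v + 16) = v * (1536 / ((t + 16) * (t + v + 16))) := by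
    field_simp
    ring
  rw [hid]
  nth_rewrite 1 [← hw]
  rw [Finset.sum_mul]
  refine Finset.sum_le_sum fun μ hμ => ?_
  rw [pow_succ' (g μ) 2]
  refine mul_le_mul_of_nonneg_left ?_ (g0 μ hμ)
  rw [le_div_iff₀ (by positivity)]
  exact sq_mul_weight_le (g0 μ hμ) (g1 μ hμ) ht hv (htg μ hμ)

lemma sum_keptMids_decayWeight_cube_le (A : Finset ℕ) (ℓ : ℕ) (x : ℝ) :
    ∑ k ∈ A, ∑ μ ∈ keptMids A ℓ k, decayWeight ((2:ℝ)^(k+ℓ) * (x - dyadicMid k μ)) ^ 3 ≤ 96 := by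
  have hstep : ∀ K : ℕ, ∑ k ∈ Finset.range K, (if k ∈ A then
      ∑ μ ∈ keptMids A ℓ k, decayWeight ((2:ℝ)^(k+ℓ) * (x - dyadicMid k μ)) ^ 3 else 0) ≤
      96 - 1536 / (accumWeight A ℓ K x + 16) := by
    intro K
    induction K with
    | zero => simp [accumWeight]; norm_num
    | succ k ih =>
      rw [Finset.sum_range_succ, accumWeight_succ]
      split_ifs with hk
      · set t := accumWeight A ℓ k x with ht
        set v := ∑ μ ∈ keptMids A ℓ k, decayWeight ((2:ℝ)^(k+ℓ) * (x - dyadicMid k μ)) with hv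
        have ht0 : 0 ≤ t := accumWeight_nonneg _ _ _ _
        have hv0 : 0 ≤ v := Finset.sum_nonneg fun _ _ => (decayWeight_pos _).le
        have hv16 : v ≤ 16 := by
          have h1 : v ≤ 4 * (1 + (2:ℝ)^k / 2^(k+ℓ)) :=
            (Finset.sum_le_sum_of_subset_of_nonneg (Finset.filter_subset _ _)
              fun _ _ _ => (decayWeight_pos _).le).trans (sum_decayWeight_dyadicMid_le k (k+ℓ) x)
          have h2 : (2:ℝ)^k / 2^(k+ℓ) ≤ 1 := by
            rw [div_le_one (by positivity)]
            exact pow_le_pow_right₀ (by norm_num) (by omega)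
          linarith
        have hmain := sum_cube_le_sub (S := keptMids A ℓ k)
          (g := fun μ => decayWeight ((2:ℝ)^(k+ℓ) * (x - dyadicMid k μ))) ht0
          (fun μ _ => (decayWeight_pos _).le) (fun μ _ => decayWeight_le_one _)
          (fun μ hμ => (accumWeight_mul_decayWeight_le A ℓ k x (dyadicMid k μ) le_rfl).trans
            (Finset.mem_filter.1 hμ).2) hv16
        rw [← hv] at hmain
        linarith
      · simpa using ih
  obtain ⟨K, hK⟩ : ∃ K, A ⊆ Finset.range K :=
    ⟨A.sup id + 1, fun k hk => Finset.mem_range.2 (Nat.lt_succ_of_le (Finset.le_sup (f := id) hk))⟩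
  have h := hstep K
  rw [Finset.sum_ite_mem, Finset.inter_eq_right.2 hK] at h
  refine h.trans ?_
  have := accumWeight_nonneg A ℓ K x
  have : 0 ≤ 1536 / (accumWeight A ℓ K x + 16) := by positivity
  linarith

lemma integral_mul_haarFn {f : ℝ → ℂ} (hf : Continuous f) (k μ : ℕ) :
    ∫ y, f y * haarFn k μ y =
      (∫ y in (dyadicMid k μ - ((2:ℝ)^k)⁻¹ / 2)..(dyadicMid k μ), f y)
        - ∫ y in (dyadicMid k μ)..(dyadicMid k μ + ((2:ℝ)^k)⁻¹ / 2), f y := by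
  have hδ : (0:ℝ) < ((2:ℝ)^k)⁻¹ / 2 := by positivity
  have e0 : (2:ℝ)^(-(k:ℤ)) = ((2:ℝ)^k)⁻¹ := by simp
  have e1 : ((2:ℝ)^k)⁻¹ * ((μ:ℤ):ℝ) = dyadicMid k μ - ((2:ℝ)^k)⁻¹ / 2 := by
    unfold dyadicMid; push_cast; ring
  have e2 : ((2:ℝ)^k)⁻¹ * (((μ:ℤ):ℝ) + 1/2) = dyadicMid k μ := by
    unfold dyadicMid; push_cast; ring
  have e3 : ((2:ℝ)^k)⁻¹ * (((μ:ℤ):ℝ) + 1) = dyadicMid k μ + ((2:ℝ)^k)⁻¹ / 2 := by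
    unfold dyadicMid; push_cast; ring
  have hi : ∀ a b : ℝ, IntegrableOn f (Set.Ico a b) := fun a b =>
    (hf.continuousOn.integrableOn_Icc (a := a) (b := b)).mono_set Set.Ico_subset_Icc_self
  have hfun : (fun y => f y * haarFn k μ y) = fun y =>
      (Set.Ico (dyadicMid k μ - ((2:ℝ)^k)⁻¹ / 2) (dyadicMid k μ)).indicator f y
      - (Set.Ico (dyadicMid k μ) (dyadicMid k μ + ((2:ℝ)^k)⁻¹ / 2)).indicator f y := by
    ext y
    unfold haarFn
    rw [e0, e1, e2, e3, mul_sub]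
    simp only [Set.indicator_apply]
    split_ifs <;> simp
  rw [hfun, integral_sub ((integrable_indicator_iff measurableSet_Ico).2 (hi _ _))
    ((integrable_indicator_iff measurableSet_Ico).2 (hi _ _)),
    integral_indicator measurableSet_Ico, integral_indicator measurableSet_Ico,
    integral_Ico_eq_integral_Ioc, integral_Ico_eq_integral_Ioc,
    intervalIntegral.integral_of_le (by linarith), intervalIntegral.integral_of_le (by linarith)]

lemma integrable_haarFn (k : ℕ) (μ : ℤ) : Integrable (haarFn k μ) := by
  unfold haarFn
  have h : ∀ a b : ℝ, Integrable ((Set.Ico a b).indicator fun _ => (1:ℂ)) := fun a b =>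
    (integrable_indicator_iff measurableSet_Ico).2 (integrableOn_const (by simp))
  exact (h _ _).sub (h _ _)

lemma measurable_haarFn (k : ℕ) (μ : ℤ) : Measurable (haarFn k μ) := by
  unfold haarFn
  exact (measurable_const.indicator measurableSet_Ico).sub
    (measurable_const.indicator measurableSet_Ico)

lemma norm_haarFn_le (k : ℕ) (μ : ℤ) (x : ℝ) : ‖haarFn k μ x‖ ≤ 2 := by
  unfold haarFn
  refine (norm_sub_le _ _).trans ?_
  have h : ∀ s : Set ℝ, ‖s.indicator (fun _ => (1:ℂ)) x‖ ≤ 1 := fun s =>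
    (norm_indicator_le_norm_self _ _).trans (by simp)
  linarith [h (Set.Ico ((2:ℝ)^(-(k:ℤ)) * μ) ((2:ℝ)^(-(k:ℤ)) * (μ + 1/2))),
    h (Set.Ico ((2:ℝ)^(-(k:ℤ)) * (μ + 1/2)) ((2:ℝ)^(-(k:ℤ)) * (μ + 1)))]

/-- A smooth probability density supported in a small neighbourhood of the origin. -/
def freqBump (ξ : ℝ) : ℂ :=
  ((⟨1/200, 1/100, by norm_num, by norm_num⟩ : ContDiffBump (0:ℝ)).normed volume ξ : ℝ)

lemma contDiff_freqBump : ContDiff ℝ (⊤ : ℕ∞) freqBump :=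
  Complex.ofRealCLM.contDiff.comp (ContDiffBump.contDiff_normed _)

lemma hasCompactSupport_freqBump : HasCompactSupport freqBump :=
  (ContDiffBump.hasCompactSupport_normed _).comp_left (g := fun x : ℝ => (x : ℂ)) (by simp)

lemma abs_le_of_freqBump_ne_zero {ξ : ℝ} (h : freqBump ξ ≠ 0) : |ξ| ≤ 1/100 := by
  have h1 : ξ ∈ Function.support
      ((⟨1/200, 1/100, by norm_num, by norm_num⟩ : ContDiffBump (0:ℝ)).normed volume) := by
    intro h0
    exact h (by unfold freqBump; rw [h0]; simp)
  rw [ContDiffBump.support_normed_eq, Metric.mem_ball, Real.dist_eq, sub_zero] at h1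
  exact h1.le

lemma norm_fourierInv_freqBump_sub_one_le (x : ℝ) :
    ‖𝓕⁻ freqBump x - 1‖ ≤ 2 * π / 100 * |x| := by
  set b : ContDiffBump (0:ℝ) := ⟨1/200, 1/100, by norm_num, by norm_num⟩ with hb
  have hint : ∫ ξ, freqBump ξ = 1 := by
    change ∫ ξ, ((b.normed volume ξ : ℝ) : ℂ) = 1
    rw [integral_complex_ofReal, b.integral_normed]
    simp
  have hI : Integrable freqBump :=
    contDiff_freqBump.continuous.integrable_of_hasCompactSupport hasCompactSupport_freqBump
  have hI2 : Integrable fun ξ : ℝ => Complex.exp (2 * π * (ξ * x) * Complex.I) * freqBump ξ :=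
    ((contDiff_exp_mul_I x).continuous.mul contDiff_freqBump.continuous).integrable_of_hasCompactSupport
      hasCompactSupport_freqBump.mul_left
  rw [fourierInv_eq_integral_exp, ← hint, ← integral_sub hI2 hI]
  have hbound : ∀ ξ : ℝ,
      ‖Complex.exp (2 * π * (ξ * x) * Complex.I) * freqBump ξ - freqBump ξ‖ ≤
        b.normed volume ξ * (2 * π / 100 * |x|) := by
    intro ξ
    by_cases h0 : freqBump ξ = 0
    · rw [h0]
      simp only [mul_zero, sub_zero, norm_zero]
      have := b.nonneg_normed (μ := volume) ξ
      positivity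
    · have h1 := abs_le_of_freqBump_ne_zero h0
      have h2 : ‖freqBump ξ‖ = b.normed volume ξ := by
        change ‖((b.normed volume ξ : ℝ) : ℂ)‖ = _
        rw [Complex.norm_real, Real.norm_of_nonneg (b.nonneg_normed ξ)]
      rw [← sub_one_mul, norm_mul, h2, mul_comm]
      refine mul_le_mul_of_nonneg_left ?_ (b.nonneg_normed ξ)
      have h3 := Real.norm_exp_I_mul_ofReal_sub_one_le (x := 2 * π * (ξ * x))
      have h4 : Complex.exp (2 * π * (ξ * x) * Complex.I)
          = Complex.exp (Complex.I * ((2 * π * (ξ * x) : ℝ) : ℂ)) := by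
        congr 1; push_cast; ring
      rw [h4]
      refine h3.trans ?_
      rw [Real.norm_eq_abs, abs_mul, abs_of_pos (by positivity : 0 < 2 * π), abs_mul]
      have : |ξ| * |x| ≤ 1/100 * |x| := by gcongr
      nlinarith [Real.pi_pos]
  refine (norm_integral_le_of_norm_le ((b.integrable_normed).mul_const _)
    (Filter.Eventually.of_forall hbound)).trans ?_
  rw [integral_mul_const, b.integral_normed, one_mul]

lemma fourierInv_comp_sub (m : ℝ → ℂ) (c x : ℝ) :
    𝓕⁻ (fun ξ => m (ξ - c)) x = Complex.exp (2 * π * (c * x) * Complex.I) * 𝓕⁻ m x := by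
  rw [fourierInv_eq_integral_exp, fourierInv_eq_integral_exp, ← integral_const_mul,
    ← integral_add_right_eq_self _ c]
  congr 1
  ext ξ
  rw [add_sub_cancel_right, ← mul_assoc (Complex.exp _) (Complex.exp _), ← Complex.exp_add]
  congr 2
  push_cast
  ring

lemma fourierInv_exp_mul (m : ℝ → ℂ) (y x : ℝ) :
    𝓕⁻ (fun ξ : ℝ => Complex.exp (2 * π * (ξ * (-y : ℝ)) * Complex.I) * m ξ) x
      = 𝓕⁻ m (x - y) := by
  rw [fourierInv_eq_integral_exp, fourierInv_eq_integral_exp]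
  congr 1
  ext ξ
  rw [← mul_assoc, ← Complex.exp_add]
  congr 2
  push_cast
  ring

/-- The test function `x ↦ exp (2 π i 2 ^ k x) ζ x`, with `ζ` band-limited. -/
def testFn (k : ℕ) : ℝ → ℂ := 𝓕⁻ (fun ξ => freqBump (ξ - (2:ℝ)^k))

lemma contDiff_freqBump_sub (c : ℝ) : ContDiff ℝ (⊤ : ℕ∞) (fun ξ => freqBump (ξ - c)) :=
  contDiff_freqBump.comp (contDiff_id.sub contDiff_const)

lemma hasCompactSupport_freqBump_sub (c : ℝ) :
    HasCompactSupport (fun ξ => freqBump (ξ - c)) :=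
  hasCompactSupport_freqBump.comp_homeomorph (Homeomorph.subRight c)

lemma freqBump_sub_supp {c ξ : ℝ} (hc : 1 ≤ c) (h : freqBump (ξ - c) ≠ 0) :
    9/10 * c ≤ |ξ| ∧ |ξ| ≤ 11/10 * c := by
  have h1 := abs_le.1 (abs_le_of_freqBump_ne_zero h)
  rw [abs_of_pos (by linarith)]
  constructor <;> linarith

lemma testFn_apply (k : ℕ) (x : ℝ) : testFn k x =
    Complex.exp (2 * π * ((2:ℝ)^k * x : ℝ) * Complex.I) * 𝓕⁻ freqBump x := by
  unfold testFn
  rw [fourierInv_comp_sub]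
  push_cast
  rfl

lemma norm_testFn (k : ℕ) (x : ℝ) : ‖testFn k x‖ = ‖𝓕⁻ freqBump x‖ := by
  rw [testFn_apply, norm_mul]
  have : (2 * π * ((2:ℝ)^k * x : ℝ) * Complex.I : ℂ)
      = ((2 * π * ((2:ℝ)^k * x) : ℝ) : ℂ) * Complex.I := by push_cast; ring
  rw [this, Complex.norm_exp_ofReal_mul_I, one_mul]

lemma continuous_fourierInv {a : ℝ → ℂ} (ha : ContDiff ℝ (⊤ : ℕ∞) a)
    (ha' : HasCompactSupport a) : Continuous (𝓕⁻ a) := by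
  rw [← fourierInv_toSchwartzMap ha ha']
  exact SchwartzMap.continuous _

lemma continuous_testFn (k : ℕ) : Continuous (testFn k) :=
  continuous_fourierInv (contDiff_freqBump_sub _) (hasCompactSupport_freqBump_sub _)

lemma norm_integral_haarFn_mul_testFn_sub_le {k μ : ℕ} (hμ : μ < 2^k) :
    ‖(∫ x, haarFn k μ x * testFn k x) - ((2:ℝ)^k : ℝ)⁻¹ * (2 / π * Complex.I)‖ ≤
      ((2:ℝ)^k)⁻¹ * (2 * π / 100) := by
  set c : ℂ := 2 * π * (2:ℝ)^k * Complex.I with hc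
  have hc0 : c ≠ 0 := by
    simp [hc, Real.pi_ne_zero]
  have hp : (0:ℝ) < 2^k := by positivity
  set δ : ℝ := ((2:ℝ)^k)⁻¹ / 2 with hδ
  have hδ0 : 0 < δ := by positivity
  set m := dyadicMid k μ with hm
  have hcexp : Continuous fun x : ℝ => Complex.exp (c * x) := by fun_prop
  have E1 : Complex.exp (c * (m - δ : ℝ)) = 1 := by
    rw [Complex.exp_eq_one_iff]
    refine ⟨μ, ?_⟩
    simp only [hc, hm, hδ, dyadicMid]
    push_cast
    field_simp
    ring
  have E2 : Complex.exp (c * (m : ℝ)) = -1 := by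
    have : c * (m : ℝ) = c * (m - δ : ℝ) + π * Complex.I := by
      simp only [hc, hδ]
      push_cast
      field_simp
      ring
    rw [this, Complex.exp_add, E1, Complex.exp_pi_mul_I, one_mul]
  have E3 : Complex.exp (c * (m + δ : ℝ)) = 1 := by
    have : c * (m + δ : ℝ) = c * (m : ℝ) + π * Complex.I := by
      simp only [hc, hδ]
      push_cast
      field_simp
    rw [this, Complex.exp_add, E2, Complex.exp_pi_mul_I]
    norm_num
  have hexact : (∫ x in (m - δ)..m, Complex.exp (c * x)) - (∫ x in m..(m + δ), Complex.exp (c * x))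
      = ((2:ℝ)^k : ℝ)⁻¹ * (2 / π * Complex.I) := by
    rw [integral_exp_mul_complex hc0, integral_exp_mul_complex hc0, E1, E2, E3, hc]
    have : (π : ℂ) ≠ 0 := by exact_mod_cast Real.pi_ne_zero
    push_cast
    field_simp
    rw [Complex.I_sq]
    norm_num
  have hdiff : ∀ x : ℝ, 0 ≤ x → x ≤ 1 → ‖testFn k x - Complex.exp (c * x)‖ ≤ 2 * π / 100 := by
    intro x h0 h1
    have e : (2 * π * ((2:ℝ)^k * x : ℝ) * Complex.I : ℂ) = c * x := by
      rw [hc]; push_cast; ring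
    have e2 : ‖Complex.exp (c * x)‖ = 1 := by
      have : c * x = ((2 * π * ((2:ℝ)^k * x) : ℝ) : ℂ) * Complex.I := by rw [hc]; push_cast; ring
      rw [this, Complex.norm_exp_ofReal_mul_I]
    rw [testFn_apply, e, ← mul_sub_one, norm_mul, e2, one_mul]
    refine (norm_fourierInv_freqBump_sub_one_le x).trans ?_
    rw [abs_of_nonneg h0]
    exact mul_le_of_le_one_right (by positivity) h1
  have hm0 : 0 ≤ m - δ := by
    have : m - δ = ((2:ℝ)^k)⁻¹ * μ := by simp only [hm, hδ, dyadicMid]; ring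
    rw [this]; positivity
  have hm1 : m + δ ≤ 1 := by
    have : m + δ = ((2:ℝ)^k)⁻¹ * (μ + 1) := by simp only [hm, hδ, dyadicMid]; ring
    rw [this, inv_mul_le_one₀ hp]
    exact_mod_cast hμ
  have hcomm : ∫ x, haarFn k μ x * testFn k x = ∫ x, testFn k x * haarFn k μ x := by
    congr 1; ext x; ring
  rw [hcomm, integral_mul_haarFn (continuous_testFn k), ← hexact, ← hδ, ← hm]
  have hit := fun a b => (continuous_testFn k).intervalIntegrable (μ := volume) a b
  have hie := fun a b => hcexp.intervalIntegrable (μ := volume) a b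
  have hsplit : ((∫ x in (m - δ)..m, testFn k x) - ∫ x in m..(m + δ), testFn k x)
      - ((∫ x in (m - δ)..m, Complex.exp (c * x)) - ∫ x in m..(m + δ), Complex.exp (c * x))
      = (∫ x in (m - δ)..m, (testFn k x - Complex.exp (c * x)))
        - ∫ x in m..(m + δ), (testFn k x - Complex.exp (c * x)) := by
    rw [intervalIntegral.integral_sub (hit _ _) (hie _ _),
      intervalIntegral.integral_sub (hit _ _) (hie _ _)]
    ring
  rw [hsplit]
  refine (norm_sub_le _ _).trans ?_
  have b1 := intervalIntegral.norm_integral_le_of_norm_le_const (a := m - δ) (b := m)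
    (f := fun x => testFn k x - Complex.exp (c * x)) (C := 2 * π / 100) (by
      intro x hx
      rw [Set.uIoc_of_le (by linarith)] at hx
      exact hdiff x (by linarith [hx.1]) (by linarith [hx.2]))
  have b2 := intervalIntegral.norm_integral_le_of_norm_le_const (a := m) (b := m + δ)
    (f := fun x => testFn k x - Complex.exp (c * x)) (C := 2 * π / 100) (by
      intro x hx
      rw [Set.uIoc_of_le (by linarith)] at hx
      exact hdiff x (by linarith [hx.1]) (by linarith [hx.2]))
  rw [sub_sub_cancel, abs_of_pos hδ0] at b1
  rw [add_sub_cancel_left, abs_of_pos hδ0] at b2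
  have : ((2:ℝ)^k)⁻¹ * (2 * π / 100) = 2 * π / 100 * δ + 2 * π / 100 * δ := by rw [hδ]; ring
  rw [this]
  exact add_le_add b1 b2

lemma exists_norm_fourierInv_le {a : ℝ → ℂ} (ha : ContDiff ℝ (⊤ : ℕ∞) a)
    (ha' : HasCompactSupport a) : ∃ C : ℝ, 0 < C ∧ ∀ y, ‖𝓕⁻ a y‖ ≤ C * decayWeight y ^ 3 := by
  rw [← fourierInv_toSchwartzMap ha ha']
  set f : SchwartzMap ℝ ℂ := 𝓕⁻ (ha'.toSchwartzMap ha)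
  set D : ℝ := 2 ^ 6 * ((Finset.Iic (6, 0)).sup fun m => SchwartzMap.seminorm ℝ m.1 m.2) f with hD
  refine ⟨|D| + 1, by positivity, fun y => ?_⟩
  have h := SchwartzMap.one_add_le_sup_seminorm_apply (𝕜 := ℝ) (m := (6, 0)) (k := 6) (n := 0)
    le_rfl le_rfl f y
  rw [norm_iteratedFDeriv_zero, Real.norm_eq_abs] at h
  have e : decayWeight y ^ 3 = ((1 + |y|) ^ 6)⁻¹ := by
    unfold decayWeight; rw [inv_pow, ← pow_mul]
  rw [e, ← div_eq_mul_inv, le_div_iff₀ (by positivity), mul_comm]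
  exact h.trans ((le_abs_self _).trans (by linarith))

/-- The symbol of the derivative of `testFn 0`. -/
def packetSymbol (ξ : ℝ) : ℂ := 2 * π * Complex.I * ξ * freqBump (ξ - (2:ℝ)^0)

lemma contDiff_packetSymbol : ContDiff ℝ (⊤ : ℕ∞) packetSymbol :=
  (contDiff_const.mul Complex.ofRealCLM.contDiff).mul (contDiff_freqBump_sub _)

lemma hasCompactSupport_packetSymbol : HasCompactSupport packetSymbol :=
  (hasCompactSupport_freqBump_sub _).mul_left

lemma hasDerivAt_testFn_zero (x : ℝ) : HasDerivAt (testFn 0) (𝓕⁻ packetSymbol x) x := by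
  have hI : Integrable fun ξ : ℝ => freqBump (ξ - (2:ℝ)^0) :=
    (contDiff_freqBump_sub _).continuous.integrable_of_hasCompactSupport
      (hasCompactSupport_freqBump_sub _)
  have hI2 : Integrable fun ξ : ℝ => ξ • freqBump (ξ - (2:ℝ)^0) :=
    (continuous_id.smul (contDiff_freqBump_sub _).continuous).integrable_of_hasCompactSupport
      (hasCompactSupport_freqBump_sub _).smul_left
  have h := (Real.hasDerivAt_fourier hI hI2 (-x)).scomp x (hasDerivAt_neg x)
  have e1 : testFn 0 = (𝓕 fun ξ : ℝ => freqBump (ξ - (2:ℝ)^0)) ∘ fun y => -y := by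
    ext y
    exact Real.fourierInv_eq_fourier_neg _ _
  rw [e1]
  refine h.congr_deriv ?_
  symm
  rw [Real.fourierInv_eq_fourier_neg, Real.fourier_eq, Real.fourier_eq, ← integral_smul]
  congr 1
  ext ξ
  simp only [packetSymbol, smul_eq_mul, Circle.smul_def, Complex.real_smul]
  push_cast
  ring

/-- The symbol of the wave packet of frequency `2 ^ n` centred at `y`. -/
def packetSym (n : ℕ) (y ξ : ℝ) : ℂ :=
  Complex.exp (2 * π * (ξ * (-y : ℝ)) * Complex.I) *
    (((2:ℝ)^n : ℝ)⁻¹ * packetSymbol (((2:ℝ)^n)⁻¹ * ξ))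

lemma contDiff_packetSym (n : ℕ) (y : ℝ) : ContDiff ℝ (⊤ : ℕ∞) (packetSym n y) :=
  (contDiff_exp_mul_I (-y)).mul
    (contDiff_const.mul (contDiff_packetSymbol.comp (contDiff_const.mul contDiff_id)))

lemma hasCompactSupport_packetSym (n : ℕ) (y : ℝ) : HasCompactSupport (packetSym n y) :=
  HasCompactSupport.mul_left (HasCompactSupport.mul_left
    (hasCompactSupport_comp_mul hasCompactSupport_packetSymbol (by positivity)))

lemma packetSym_supp {n : ℕ} {y ξ : ℝ} (h : packetSym n y ξ ≠ 0) :
    9/10 * (2:ℝ)^n ≤ |ξ| ∧ |ξ| ≤ 11/10 * (2:ℝ)^n := by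
  have hp : (0:ℝ) < 2^n := by positivity
  have h1 : freqBump (((2:ℝ)^n)⁻¹ * ξ - 2^0) ≠ 0 := by
    intro h0
    exact h (by simp only [packetSym, packetSymbol]; rw [h0]; simp)
  have h2 := freqBump_sub_supp (by norm_num) h1
  rw [abs_mul, abs_of_pos (inv_pos.2 hp), pow_zero, mul_one, mul_one, ← div_eq_inv_mul,
    le_div_iff₀ hp, div_le_iff₀ hp] at h2
  exact h2

/-- The wave packet of frequency `2 ^ n` centred at `y`. -/
def packet (n : ℕ) (y : ℝ) : SchwartzMap ℝ ℂ :=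
  𝓕⁻ ((hasCompactSupport_packetSym n y).toSchwartzMap (contDiff_packetSym n y))

lemma coe_packet (n : ℕ) (y : ℝ) : (packet n y : ℝ → ℂ) = 𝓕⁻ (packetSym n y) :=
  fourierInv_toSchwartzMap _ _

lemma packet_apply (n : ℕ) (y x : ℝ) :
    packet n y x = 𝓕⁻ packetSymbol ((2:ℝ)^n * (x - y)) := by
  have hp : (0:ℝ) < 2^n := by positivity
  have h : 𝓕⁻ (fun ξ => (((2:ℝ)^n : ℝ)⁻¹ : ℝ) * packetSymbol (((2:ℝ)^n)⁻¹ * ξ)) (x - y)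
      = 𝓕⁻ packetSymbol ((2:ℝ)^n * (x - y)) := by
    have h2 := fourierInv_comp_mul packetSymbol hp (x - y)
    rw [fourierInv_eq_integral_exp] at h2 ⊢
    simp_rw [mul_left_comm _ ((((2:ℝ)^n)⁻¹ : ℝ) : ℂ)]
    rw [integral_const_mul, h2, ← mul_assoc, ← Complex.ofReal_mul, inv_mul_cancel₀ hp.ne',
      Complex.ofReal_one, one_mul]
  rw [coe_packet]
  exact (fourierInv_exp_mul _ y x).trans h

lemma LPop_packet {φ₀ : ℝ → ℂ} (hφsmooth : ContDiff ℝ (⊤ : ℕ∞) φ₀)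
    (hφcpt : HasCompactSupport φ₀) (hφone : ∀ ξ : ℝ, |ξ| ≤ 4/3 → φ₀ ξ = 1)
    (hφzero : ∀ ξ : ℝ, 3/2 ≤ |ξ| → φ₀ ξ = 0) (n : ℕ) (y : ℝ) (l : ℕ) (x : ℝ) :
    LPop φ₀ l (packet n y) x = if l = n then packet n y x else 0 := by
  rw [coe_packet]
  exact LPop_fourierInv hφsmooth hφcpt hφone hφzero (contDiff_packetSym n y)
    (hasCompactSupport_packetSym n y) (fun _ => packetSym_supp) l x

lemma integral_packet_mul_haarFn (k ℓ μ : ℕ) :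
    ∫ x, packet (k + ℓ) (dyadicMid k μ) x * haarFn k μ x =
      (((2:ℝ)^(k + ℓ))⁻¹ : ℝ) *
        (2 * testFn 0 0 - testFn 0 (-(2^ℓ / 2)) - testFn 0 (2^ℓ / 2)) := by
  set m := dyadicMid k μ
  have hp : (0:ℝ) < 2^(k + ℓ) := by positivity
  have hd : ∀ x, HasDerivAt
      (fun x => (((2:ℝ)^(k + ℓ))⁻¹ : ℝ) * testFn 0 ((2:ℝ)^(k + ℓ) * (x - m)))
      (packet (k + ℓ) m x) x := by
    intro x
    have h1 : HasDerivAt (fun x : ℝ => (2:ℝ)^(k + ℓ) * (x - m)) ((2:ℝ)^(k + ℓ)) x := by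
      simpa using ((hasDerivAt_id x).sub_const m).const_mul ((2:ℝ)^(k + ℓ))
    have h2 := ((hasDerivAt_testFn_zero ((2:ℝ)^(k + ℓ) * (x - m))).scomp x h1).const_mul
      ((((2:ℝ)^(k + ℓ))⁻¹ : ℝ) : ℂ)
    refine h2.congr_deriv ?_
    rw [packet_apply, Complex.real_smul, ← mul_assoc, ← Complex.ofReal_mul, inv_mul_cancel₀ hp.ne',
      Complex.ofReal_one, one_mul]
  have hc : Continuous (packet (k + ℓ) m) := SchwartzMap.continuous _
  rw [integral_mul_haarFn hc,
    intervalIntegral.integral_eq_sub_of_hasDerivAt (fun x _ => hd x) (hc.intervalIntegrable _ _),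
    intervalIntegral.integral_eq_sub_of_hasDerivAt (fun x _ => hd x) (hc.intervalIntegrable _ _)]
  have e1 : (2:ℝ)^(k + ℓ) * (m - ((2:ℝ)^k)⁻¹ / 2 - m) = -(2^ℓ / 2) := by
    rw [pow_add]; field_simp; ring
  have e2 : (2:ℝ)^(k + ℓ) * (m + ((2:ℝ)^k)⁻¹ / 2 - m) = 2^ℓ / 2 := by
    rw [pow_add]; field_simp; ring
  change _ * testFn 0 _ - _ * testFn 0 ((2:ℝ)^(k + ℓ) * (m - ((2:ℝ)^k)⁻¹ / 2 - m)) -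
    (_ * testFn 0 ((2:ℝ)^(k + ℓ) * (m + ((2:ℝ)^k)⁻¹ / 2 - m)) - _) = _
  rw [e1, e2, sub_self, mul_zero]
  ring

lemma testFn_zero_zero : testFn 0 0 = 1 := by
  have h := norm_fourierInv_freqBump_sub_one_le 0
  rw [abs_zero, mul_zero, norm_le_zero_iff, sub_eq_zero] at h
  rw [testFn_apply, h]
  simp

lemma exists_norm_testFn_zero_le :
    ∃ ℓ₀ : ℕ, ∀ t : ℝ, (2:ℝ)^ℓ₀ / 2 ≤ |t| → ‖testFn 0 t‖ ≤ 1/2 := by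
  obtain ⟨C, hC, h⟩ := exists_norm_fourierInv_le (contDiff_freqBump_sub ((2:ℝ)^0))
    (hasCompactSupport_freqBump_sub _)
  obtain ⟨ℓ₀, hℓ⟩ := pow_unbounded_of_one_lt (4 * C) (one_lt_two)
  refine ⟨ℓ₀, fun t ht => (h t).trans ?_⟩
  have h1 : decayWeight t ^ 3 ≤ decayWeight t :=
    pow_le_of_le_one (decayWeight_pos t).le (decayWeight_le_one t) (by norm_num)
  have h2 : decayWeight t ≤ 1 / (2 * C) := by
    unfold decayWeight
    rw [← one_div]
    apply one_div_le_one_div_of_le (by positivity)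
    nlinarith [abs_nonneg t]
  calc C * decayWeight t ^ 3 ≤ C * (1 / (2 * C)) := by gcongr; exact h1.trans h2
    _ = 1/2 := by field_simp

/-- The diagonal coefficient of the Haar matrix, tested against a modulated bump. -/
lemma diag_coeff_le {ℓ₀ : ℕ} (hℓ₀ : ∀ t : ℝ, (2:ℝ)^ℓ₀ / 2 ≤ |t| → ‖testFn 0 t‖ ≤ 1/2)
    {k ℓ μ : ℕ} (hℓ : ℓ₀ ≤ ℓ) (hμ : μ < 2^k) :
    1/4 * (((2:ℝ)^(k + ℓ))⁻¹ * ((2:ℝ)^k)⁻¹) ≤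
      (-Complex.I * ((∫ x, packet (k + ℓ) (dyadicMid k μ) x * haarFn k μ x) *
        ∫ x, haarFn k μ x * testFn k x)).re := by
  have hp : (0:ℝ) < 2^k := by positivity
  have hpn : (0:ℝ) < 2^(k+ℓ) := by positivity
  rw [integral_packet_mul_haarFn, testFn_zero_zero]
  set Y := ∫ x, haarFn k μ x * testFn k x with hY
  have hYb := norm_integral_haarFn_mul_testFn_sub_le hμ
  rw [← hY] at hYb
  have hmono : (2:ℝ)^ℓ₀ / 2 ≤ 2^ℓ / 2 := by gcongr; norm_num
  have hL : (0:ℝ) < 2^ℓ / 2 := by positivity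
  have f1 := hℓ₀ (-(2^ℓ / 2)) (by rw [abs_neg, abs_of_pos hL]; exact hmono)
  have f2 := hℓ₀ (2^ℓ / 2) (by rw [abs_of_pos hL]; exact hmono)
  set u := testFn 0 (-(2^ℓ / 2)) + testFn 0 (2^ℓ / 2) with hu
  have hub : ‖u‖ ≤ 1 := (norm_add_le _ _).trans (by linarith)
  set w : ℂ := -Complex.I * ((2:ℝ)^k : ℝ) * Y - 2 / π with hw
  have hwb : ‖w‖ ≤ 2 * π / 100 := by
    have e : w = -Complex.I * ((2:ℝ)^k : ℝ) * (Y - ((2:ℝ)^k : ℝ)⁻¹ * (2 / π * Complex.I)) := by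
      rw [hw]
      have : ((2:ℝ)^k : ℂ) ≠ 0 := by exact_mod_cast hp.ne'
      push_cast at this ⊢
      field_simp
      linear_combination (-2) * Complex.I_sq
    rw [e, norm_mul, norm_mul, norm_neg, Complex.norm_I, one_mul, Complex.norm_real,
      Real.norm_of_nonneg hp.le]
    calc (2:ℝ)^k * _ ≤ (2:ℝ)^k * (((2:ℝ)^k)⁻¹ * (2 * π / 100)) := by gcongr
      _ = 2 * π / 100 := by field_simp
  have e2 : -Complex.I * ((((2:ℝ)^(k + ℓ))⁻¹ : ℝ) *
        (2 * 1 - testFn 0 (-(2^ℓ / 2)) - testFn 0 (2^ℓ / 2)) * Y)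
      = ((((2:ℝ)^(k + ℓ))⁻¹ * ((2:ℝ)^k)⁻¹ : ℝ) : ℂ) * ((2 - u) * (2 / π + w)) := by
    have : ((2:ℝ)^k : ℂ) ≠ 0 := by exact_mod_cast hp.ne'
    rw [hw, hu]
    push_cast at this ⊢
    field_simp
    ring
  rw [e2, Complex.re_ofReal_mul, mul_comm]
  gcongr
  have e3 : (2 - u) * (2 / π + w) = ((4 / π : ℝ) : ℂ) + (2 * w - u * (((2 / π : ℝ) : ℂ) + w)) := by
    push_cast; ring
  rw [e3, Complex.add_re, Complex.ofReal_re]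
  have n1 : ‖2 * w - u * (((2 / π : ℝ) : ℂ) + w)‖ ≤ 2 * (2 * π / 100) + (2 / π + 2 * π / 100) := by
    refine (norm_sub_le _ _).trans (add_le_add ?_ ?_)
    · rw [norm_mul]; norm_num; linarith
    · rw [norm_mul]
      have : ‖((2 / π : ℝ) : ℂ) + w‖ ≤ 2 / π + 2 * π / 100 := by
        refine (norm_add_le _ _).trans (add_le_add ?_ hwb)
        rw [Complex.norm_real, Real.norm_of_nonneg (by positivity)]
      calc _ ≤ 1 * (2 / π + 2 * π / 100) := by gcongr
        _ = _ := one_mul _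
  have n2 := (abs_le.1 ((Complex.abs_re_le_norm _).trans n1)).1
  have n3 : 4 / π = 2 / π + 2 / π := by ring
  have n4 : 1/2 ≤ 2 / π := by
    rw [le_div_iff₀ Real.pi_pos]; linarith [Real.pi_le_four]
  have n5 := Real.pi_le_four
  linarith

lemma integrable_mul_fourierInv {a g : ℝ → ℂ} (ha : ContDiff ℝ (⊤ : ℕ∞) a)
    (ha' : HasCompactSupport a) (hg : Integrable g) (x : ℝ) :
    Integrable fun t => g t * 𝓕⁻ a (x - t) := by
  obtain ⟨C, hC, h⟩ := exists_norm_fourierInv_le ha ha'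
  refine hg.mul_bdd (c := C)
    ((continuous_fourierInv ha ha').comp (continuous_const.sub continuous_id)).aestronglyMeasurable
    (Filter.Eventually.of_forall fun t => (h _).trans ?_)
  exact mul_le_of_le_one_right hC.le (pow_le_one₀ (decayWeight_pos _).le (decayWeight_le_one _))

lemma LPop_sum {φ₀ : ℝ → ℂ} (hφsmooth : ContDiff ℝ (⊤ : ℕ∞) φ₀) (hφcpt : HasCompactSupport φ₀)
    {ι : Type*} (J : Finset ι) (c : ι → ℂ) {g : ι → ℝ → ℂ} (hg : ∀ i, Integrable (g i))
    (l : ℕ) (x : ℝ) :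
    LPop φ₀ l (fun y => ∑ i ∈ J, c i * g i y) x = ∑ i ∈ J, c i * LPop φ₀ l (g i) x := by
  simp only [LPop_eq, conv, Finset.sum_mul, mul_assoc]
  rw [integral_finsetSum]
  · simp only [integral_const_mul]
  · intro i _
    exact (integrable_mul_fourierInv (contDiff_lpSymbol hφsmooth l)
      (hasCompactSupport_lpSymbol hφcpt l) (hg i) x).const_mul _

lemma continuous_LPop {φ₀ : ℝ → ℂ} (hφsmooth : ContDiff ℝ (⊤ : ℕ∞) φ₀)
    (hφcpt : HasCompactSupport φ₀) {g : ℝ → ℂ} (hg : Integrable g) (l : ℕ) :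
    Continuous (LPop φ₀ l g) := by
  have ha := contDiff_lpSymbol hφsmooth l
  have ha' := hasCompactSupport_lpSymbol hφcpt l
  obtain ⟨C, hC, h⟩ := exists_norm_fourierInv_le ha ha'
  rw [LPop_eq]
  refine continuous_of_dominated (bound := fun t => ‖g t‖ * C)
    (fun x => (integrable_mul_fourierInv ha ha' hg x).aestronglyMeasurable)
    (fun x => Filter.Eventually.of_forall fun t => ?_) (hg.norm.mul_const C)
    (Filter.Eventually.of_forall fun t => continuous_const.mul
      ((continuous_fourierInv ha ha').comp (continuous_id.sub continuous_const)))
  rw [norm_mul]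
  gcongr
  exact (h _).trans
    (mul_le_of_le_one_right hC.le (pow_le_one₀ (decayWeight_pos _).le (decayWeight_le_one _)))

lemma sum_rpow_le_rpow_sum {ι : Type*} (J : Finset ι) (f : ι → ℝ≥0∞) {q : ℝ} (hq : 1 ≤ q) :
    ∑ i ∈ J, f i ^ q ≤ (∑ i ∈ J, f i) ^ q := by
  classical
  induction J using Finset.induction_on with
  | empty => simp
  | insert a J ha ih =>
    rw [Finset.sum_insert ha, Finset.sum_insert ha]
    exact (add_le_add_right ih _).trans (ENNReal.add_rpow_le_rpow_add _ _ hq)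

/-- The superposition of the wave packets at the kept midpoints, with amplitudes `ε`. -/
def packetSum (A : Finset ℕ) (ℓ : ℕ) (s : ℝ) (ε : (Σ _ : ℕ, ℕ) → ℝ) : SchwartzMap ℝ ℂ :=
  ∑ i ∈ A.sigma (keptMids A ℓ),
    ((ε i * (2:ℝ)^(-((i.1 + ℓ : ℕ) : ℝ) * s) : ℝ) : ℂ) • packet (i.1 + ℓ) (dyadicMid i.1 i.2)

lemma packetSum_apply (A : Finset ℕ) (ℓ : ℕ) (s : ℝ) (ε : (Σ _ : ℕ, ℕ) → ℝ) (x : ℝ) :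
    packetSum A ℓ s ε x = ∑ i ∈ A.sigma (keptMids A ℓ),
      ((ε i * (2:ℝ)^(-((i.1 + ℓ : ℕ) : ℝ) * s) : ℝ) : ℂ) *
        packet (i.1 + ℓ) (dyadicMid i.1 i.2) x := by
  simp [packetSum]

lemma tsum_LPop_packetSum {φ₀ : ℝ → ℂ} (hφsmooth : ContDiff ℝ (⊤ : ℕ∞) φ₀)
    (hφcpt : HasCompactSupport φ₀) (hφone : ∀ ξ : ℝ, |ξ| ≤ 4/3 → φ₀ ξ = 1)
    (hφzero : ∀ ξ : ℝ, 3/2 ≤ |ξ| → φ₀ ξ = 0) {q : ℝ} (hq : 1 < q) (A : Finset ℕ) (ℓ : ℕ) (s : ℝ)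
    (ε : (Σ _ : ℕ, ℕ) → ℝ) (x : ℝ) :
    ∑' l : ℕ, ENNReal.ofReal ((2:ℝ)^((l:ℝ)*s*q)) *
        (ENNReal.ofReal ‖LPop φ₀ l (packetSum A ℓ s ε) x‖)^q =
      ∑ k ∈ A, ENNReal.ofReal ‖∑ μ ∈ keptMids A ℓ k,
        (ε ⟨k, μ⟩ : ℂ) * packet (k + ℓ) (dyadicMid k μ) x‖ ^ q := by
  have hL : ∀ l, LPop φ₀ l (packetSum A ℓ s ε) x = ∑ k ∈ A, if l = k + ℓ then
      (((2:ℝ)^(-((k + ℓ : ℕ) : ℝ) * s) : ℝ) : ℂ) * ∑ μ ∈ keptMids A ℓ k,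
        (ε ⟨k, μ⟩ : ℂ) * packet (k + ℓ) (dyadicMid k μ) x else 0 := by
    intro l
    have e : (packetSum A ℓ s ε : ℝ → ℂ) = fun x => ∑ i ∈ A.sigma (keptMids A ℓ),
        ((ε i * (2:ℝ)^(-((i.1 + ℓ : ℕ) : ℝ) * s) : ℝ) : ℂ) *
          packet (i.1 + ℓ) (dyadicMid i.1 i.2) x := funext (packetSum_apply A ℓ s ε)
    rw [e, LPop_sum hφsmooth hφcpt _ _
      (g := fun i : (Σ _ : ℕ, ℕ) => packet (i.1 + ℓ) (dyadicMid i.1 i.2))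
      (fun i => SchwartzMap.integrable _), Finset.sum_sigma]
    refine Finset.sum_congr rfl fun k _ => ?_
    split_ifs with h
    · rw [Finset.mul_sum]
      refine Finset.sum_congr rfl fun μ _ => ?_
      rw [LPop_packet hφsmooth hφcpt hφone hφzero, if_pos h]
      push_cast
      ring
    · refine Finset.sum_eq_zero fun μ _ => ?_
      rw [LPop_packet hφsmooth hφcpt hφone hφzero, if_neg h, mul_zero]
  rw [tsum_eq_sum (s := A.image (· + ℓ))]
  · rw [Finset.sum_image (by intro a _ b _ h; exact Nat.add_right_cancel h)]
    refine Finset.sum_congr rfl fun k hk => ?_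
    rw [hL, Finset.sum_eq_single k (fun b _ hb => if_neg (by omega)) (fun h => absurd hk h),
      if_pos rfl, norm_mul, Complex.norm_real, Real.norm_of_nonneg (by positivity),
      ENNReal.ofReal_mul (by positivity), ENNReal.mul_rpow_of_nonneg _ _ (by linarith),
      ENNReal.ofReal_rpow_of_nonneg (by positivity) (by linarith), ← mul_assoc,
      ← ENNReal.ofReal_mul (by positivity), ← Real.rpow_mul (by norm_num),
      ← Real.rpow_add (by norm_num)]
    have : ((k + ℓ : ℕ) : ℝ) * s * q + -((k + ℓ : ℕ) : ℝ) * s * q = 0 := by ring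
    rw [this, Real.rpow_zero, ENNReal.ofReal_one, one_mul]
  · intro l hl
    have h0 : LPop φ₀ l (packetSum A ℓ s ε) x = 0 := by
      rw [hL]
      refine Finset.sum_eq_zero fun k hk => if_neg ?_
      rintro rfl
      exact hl (Finset.mem_image_of_mem _ hk)
    rw [h0, norm_zero, ENNReal.ofReal_zero, ENNReal.zero_rpow_of_pos (by linarith), mul_zero]

lemma lintegral_packet (n : ℕ) (y : ℝ) :
    ∫⁻ x, ENNReal.ofReal ‖packet n y x‖ =
      ENNReal.ofReal (((2:ℝ)^n)⁻¹ * ∫ x, ‖𝓕⁻ packetSymbol x‖) := by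
  rw [← ofReal_integral_eq_lintegral_ofReal (SchwartzMap.integrable _).norm
    (Filter.Eventually.of_forall fun _ => norm_nonneg _)]
  simp only [packet_apply]
  rw [integral_sub_right_eq_self (fun x => ‖𝓕⁻ packetSymbol ((2:ℝ)^n * x)‖) y,
    Measure.integral_comp_mul_left (fun x => ‖𝓕⁻ packetSymbol x‖), smul_eq_mul,
    abs_of_pos (by positivity)]

lemma exists_FNorm_packetSum_le {φ₀ : ℝ → ℂ} (hφsmooth : ContDiff ℝ (⊤ : ℕ∞) φ₀)
    (hφcpt : HasCompactSupport φ₀) (hφone : ∀ ξ : ℝ, |ξ| ≤ 4/3 → φ₀ ξ = 1)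
    (hφzero : ∀ ξ : ℝ, 3/2 ≤ |ξ| → φ₀ ξ = 0) {p q : ℝ} (hq : 1 < q) (hqp : q < p) (s : ℝ) :
    ∃ C : ℝ, 0 < C ∧ ∀ (A : Finset ℕ) (ℓ : ℕ), A.card ≤ 2^ℓ →
      ∀ ε : (Σ _ : ℕ, ℕ) → ℝ, (∀ i, |ε i| ≤ 1) →
        FNorm φ₀ p q s (packetSum A ℓ s ε) ≤ ENNReal.ofReal C := by
  obtain ⟨C, hC, hdecay⟩ :=
    exists_norm_fourierInv_le contDiff_packetSymbol hasCompactSupport_packetSymbol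
  set I : ℝ := ∫ x, ‖𝓕⁻ packetSymbol x‖ with hI
  have hI0 : 0 ≤ I := integral_nonneg fun _ => norm_nonneg _
  refine ⟨((96 * C)^(p-1) * (I + 1))^(1/p), by positivity, fun A ℓ hA ε hε => ?_⟩
  set w : ℕ → ℝ → ℝ := fun k x =>
    ‖∑ μ ∈ keptMids A ℓ k, (ε ⟨k, μ⟩ : ℂ) * packet (k + ℓ) (dyadicMid k μ) x‖ with hw
  have hw1 : ∀ k x, w k x ≤ ∑ μ ∈ keptMids A ℓ k, ‖packet (k + ℓ) (dyadicMid k μ) x‖ := by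
    intro k x
    refine (norm_sum_le _ _).trans (Finset.sum_le_sum fun μ _ => ?_)
    rw [norm_mul, Complex.norm_real, Real.norm_eq_abs]
    exact mul_le_of_le_one_left (norm_nonneg _) (hε _)
  have hw2 : ∀ x, ∑ k ∈ A, w k x ≤ 96 * C := by
    intro x
    calc ∑ k ∈ A, w k x ≤ ∑ k ∈ A, ∑ μ ∈ keptMids A ℓ k,
          C * decayWeight ((2:ℝ)^(k+ℓ) * (x - dyadicMid k μ)) ^ 3 := by
          refine Finset.sum_le_sum fun k _ => (hw1 k x).trans (Finset.sum_le_sum fun μ _ => ?_)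
          rw [packet_apply]
          exact hdecay _
      _ = C * ∑ k ∈ A, ∑ μ ∈ keptMids A ℓ k,
          decayWeight ((2:ℝ)^(k+ℓ) * (x - dyadicMid k μ)) ^ 3 := by
          simp only [Finset.mul_sum]
      _ ≤ C * 96 := by gcongr; exact sum_keptMids_decayWeight_cube_le A ℓ x
      _ = 96 * C := mul_comm _ _
  have hpt : ∀ x, (∑ k ∈ A, ENNReal.ofReal (w k x) ^ q) ^ (p/q) ≤
      ENNReal.ofReal ((96 * C)^(p-1)) * ∑ k ∈ A, ∑ μ ∈ keptMids A ℓ k,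
        ENNReal.ofReal ‖packet (k + ℓ) (dyadicMid k μ) x‖ := by
    intro x
    have hS : ∑ k ∈ A, ENNReal.ofReal (w k x) = ENNReal.ofReal (∑ k ∈ A, w k x) :=
      (ENNReal.ofReal_sum_of_nonneg fun _ _ => norm_nonneg _).symm
    calc (∑ k ∈ A, ENNReal.ofReal (w k x) ^ q) ^ (p/q)
        ≤ ((∑ k ∈ A, ENNReal.ofReal (w k x)) ^ q) ^ (p/q) := by
          gcongr
          · exact div_nonneg (by linarith) (by linarith)
          · exact sum_rpow_le_rpow_sum _ _ hq.le
      _ = (∑ k ∈ A, ENNReal.ofReal (w k x)) ^ (p - 1) * ∑ k ∈ A, ENNReal.ofReal (w k x) := by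
          rw [← ENNReal.rpow_mul, mul_div_cancel₀ _ (by linarith : q ≠ 0)]
          conv_lhs => rw [← sub_add_cancel p 1]
          rw [ENNReal.rpow_add_of_nonneg _ _ (by linarith) (by norm_num), ENNReal.rpow_one]
      _ ≤ _ := by
          gcongr
          · rw [← ENNReal.ofReal_rpow_of_nonneg (by positivity) (by linarith), hS]
            gcongr
            · linarith
            · exact hw2 x
          · rw [← ENNReal.ofReal_sum_of_nonneg fun _ _ => norm_nonneg _]
            exact ENNReal.ofReal_le_ofReal (hw1 _ x)
  have hint : ∫⁻ x, ∑ k ∈ A, ∑ μ ∈ keptMids A ℓ k,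
      ENNReal.ofReal ‖packet (k + ℓ) (dyadicMid k μ) x‖ ≤ ENNReal.ofReal (I + 1) := by
    have hm : ∀ k μ, Measurable fun x =>
        ENNReal.ofReal ‖packet (k + ℓ) (dyadicMid k μ) x‖ := fun k μ =>
      (ENNReal.continuous_ofReal.comp (SchwartzMap.continuous _).norm).measurable
    rw [lintegral_finsetSum _ fun k _ => Finset.measurable_fun_sum _ fun μ _ => hm k μ]
    simp_rw [lintegral_finsetSum _ fun μ _ => hm _ μ, lintegral_packet, ← hI, Finset.sum_const,
      nsmul_eq_mul]
    have hk : ∀ k, ((keptMids A ℓ k).card : ℝ≥0∞) * ENNReal.ofReal (((2:ℝ)^(k+ℓ))⁻¹ * I) ≤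
        ENNReal.ofReal (((2:ℝ)^ℓ)⁻¹ * I) := by
      intro k
      have hc : ((keptMids A ℓ k).card : ℝ) ≤ 2^k := by
        have : (keptMids A ℓ k).card ≤ (Finset.range (2^k)).card :=
          Finset.card_le_card (Finset.filter_subset _ _)
        rw [Finset.card_range] at this
        exact_mod_cast this
      rw [← ENNReal.ofReal_natCast, ← ENNReal.ofReal_mul (by positivity)]
      apply ENNReal.ofReal_le_ofReal
      calc ((keptMids A ℓ k).card : ℝ) * (((2:ℝ)^(k+ℓ))⁻¹ * I)
          ≤ 2^k * (((2:ℝ)^(k+ℓ))⁻¹ * I) := by gcongr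
        _ = ((2:ℝ)^ℓ)⁻¹ * I := by rw [pow_add]; field_simp
    refine (Finset.sum_le_sum fun k _ => hk k).trans ?_
    rw [Finset.sum_const, nsmul_eq_mul, ← ENNReal.ofReal_natCast,
      ← ENNReal.ofReal_mul (by positivity)]
    apply ENNReal.ofReal_le_ofReal
    have hc : (A.card : ℝ) ≤ 2^ℓ := by exact_mod_cast hA
    calc (A.card : ℝ) * (((2:ℝ)^ℓ)⁻¹ * I) ≤ 2^ℓ * (((2:ℝ)^ℓ)⁻¹ * I) := by gcongr
      _ = I := by field_simp
      _ ≤ I + 1 := by linarith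
  have hp : 0 ≤ 1/p := by
    have : 0 < p := by linarith
    positivity
  unfold FNorm
  rw [← ENNReal.ofReal_rpow_of_nonneg (by positivity) hp]
  refine ENNReal.rpow_le_rpow ?_ hp
  simp_rw [tsum_LPop_packetSum hφsmooth hφcpt hφone hφzero hq A ℓ s ε]
  refine (lintegral_mono hpt).trans ?_
  rw [lintegral_const_mul' _ _ ENNReal.ofReal_ne_top, ENNReal.ofReal_mul (by positivity)]
  gcongr

lemma exists_sum_integral_testFn_le {φ₀ : ℝ → ℂ} (hφsmooth : ContDiff ℝ (⊤ : ℕ∞) φ₀)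
    (hφcpt : HasCompactSupport φ₀) (hφone : ∀ ξ : ℝ, |ξ| ≤ 4/3 → φ₀ ξ = 1)
    (hφzero : ∀ ξ : ℝ, 3/2 ≤ |ξ| → φ₀ ξ = 0) {p q : ℝ} (hq : 1 < q) (hp : 1 < p) (s : ℝ) :
    ∃ Z : ℝ, 0 < Z ∧ ∀ (A : Finset ℕ) (g : ℝ → ℂ), Integrable g →
      ENNReal.ofReal (∑ k ∈ A, (2:ℝ)^((k:ℝ) * s) * ‖∫ x, g x * testFn k x‖) ≤
        ENNReal.ofReal ((A.card : ℝ)^(1 - 1/q) * Z) * FNorm φ₀ p q s g := by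
  have hpc : p.HolderConjugate (p / (p - 1)) := .conjExponent hp
  set r := p / (p - 1)
  have hr : 0 < r := hpc.symm.pos
  have hζc : Continuous (𝓕⁻ freqBump) :=
    continuous_fourierInv contDiff_freqBump hasCompactSupport_freqBump
  have hζ : ∫⁻ x, ‖𝓕⁻ freqBump x‖ₑ ^ r ≠ ∞ := by
    have h : MemLp (𝓕⁻ freqBump) (ENNReal.ofReal r) := by
      rw [← fourierInv_toSchwartzMap contDiff_freqBump hasCompactSupport_freqBump]
      exact SchwartzMap.memLp _ _ volume
    have h2 := lintegral_rpow_enorm_lt_top_of_eLpNorm_lt_top (by simpa using hr) (by simp) h.2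
    rw [ENNReal.toReal_ofReal hr.le] at h2
    exact h2.ne
  set Zₑ : ℝ≥0∞ := (∫⁻ x, ‖𝓕⁻ freqBump x‖ₑ ^ r) ^ (1/r) with hZₑ
  have hZtop : Zₑ ≠ ∞ := ENNReal.rpow_ne_top_of_nonneg (by positivity) hζ
  refine ⟨Zₑ.toReal + 1, by positivity, fun A g hg => ?_⟩
  have hZ : Zₑ ≤ ENNReal.ofReal (Zₑ.toReal + 1) := by
    rw [ENNReal.le_ofReal_iff_toReal_le hZtop (by positivity)]
    linarith
  have hmeas : ∀ l, Measurable fun x => ‖LPop φ₀ l g x‖ₑ := fun l =>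
    (continuous_LPop hφsmooth hφcpt hg l).enorm.measurable
  set S : ℝ → ℝ≥0∞ := fun x => ∑' k : ℕ, ENNReal.ofReal ((2:ℝ)^((k:ℝ)*s*q)) *
      (ENNReal.ofReal ‖LPop φ₀ k g x‖)^q with hS
  have hSm : Measurable S := Measurable.tsum fun k => by
    simp_rw [ofReal_norm]
    exact ((hmeas k).pow_const q).const_mul _
  have hterm : ∀ k : ℕ, ENNReal.ofReal ((2:ℝ)^((k:ℝ) * s) * ‖∫ x, g x * testFn k x‖) ≤
      ∫⁻ x, ENNReal.ofReal ((2:ℝ)^((k:ℝ) * s)) * ‖LPop φ₀ k g x‖ₑ * ‖𝓕⁻ freqBump x‖ₑ := by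
    intro k
    have h := integral_LPop_mul hφsmooth hφcpt hφone hφzero (contDiff_freqBump_sub ((2:ℝ)^k))
      (hasCompactSupport_freqBump_sub _)
      (fun ξ => freqBump_sub_supp (c := (2:ℝ)^k) (one_le_pow₀ (by norm_num))) hg
    change ∫ x, _ * testFn k x = ∫ x, _ * testFn k x at h
    rw [← h, ENNReal.ofReal_mul (by positivity), ofReal_norm]
    simp_rw [mul_assoc]
    rw [lintegral_const_mul' _ _ ENNReal.ofReal_ne_top]
    gcongr
    refine (enorm_integral_le_lintegral_enorm _).trans (le_of_eq ?_)
    refine lintegral_congr fun x => ?_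
    rw [enorm_mul, ← ofReal_norm (testFn k x), norm_testFn, ofReal_norm]
  have hpt : ∀ x, ∑ k ∈ A, ENNReal.ofReal ((2:ℝ)^((k:ℝ) * s)) * ‖LPop φ₀ k g x‖ₑ ≤
      ENNReal.ofReal ((A.card : ℝ)^(1 - 1/q)) * S x ^ (1/q) := by
    intro x
    have h1 := ENNReal.rpow_sum_le_const_mul_sum_rpow A
      (fun k => ENNReal.ofReal ((2:ℝ)^((k:ℝ) * s)) * ‖LPop φ₀ k g x‖ₑ) hq.le
    have h2 : ∑ k ∈ A, (ENNReal.ofReal ((2:ℝ)^((k:ℝ) * s)) * ‖LPop φ₀ k g x‖ₑ) ^ q ≤ S x := by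
      refine le_trans (le_of_eq ?_) (ENNReal.sum_le_tsum A)
      refine Finset.sum_congr rfl fun k _ => ?_
      rw [ENNReal.mul_rpow_of_nonneg _ _ (by linarith),
        ENNReal.ofReal_rpow_of_nonneg (by positivity) (by linarith),
        ← Real.rpow_mul (by norm_num), ofReal_norm]
    have hq0 : 0 < 1/q := by positivity
    have h3 := ENNReal.rpow_le_rpow (h1.trans (mul_le_mul_right h2 _)) hq0.le
    rw [← ENNReal.rpow_mul, mul_one_div_cancel (by linarith), ENNReal.rpow_one,
      ENNReal.mul_rpow_of_nonneg _ _ hq0.le, ← ENNReal.rpow_mul] at h3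
    refine h3.trans (le_of_eq ?_)
    congr 1
    have e : (q - 1) * (1/q) = 1 - 1/q := by field_simp
    rw [e, ← ENNReal.ofReal_natCast, ENNReal.ofReal_rpow_of_nonneg (by positivity)]
    rw [sub_nonneg, div_le_one (by linarith)]
    exact hq.le
  calc ENNReal.ofReal (∑ k ∈ A, (2:ℝ)^((k:ℝ) * s) * ‖∫ x, g x * testFn k x‖)
      = ∑ k ∈ A, ENNReal.ofReal ((2:ℝ)^((k:ℝ) * s) * ‖∫ x, g x * testFn k x‖) :=
        ENNReal.ofReal_sum_of_nonneg fun _ _ => by positivity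
    _ ≤ ∑ k ∈ A, ∫⁻ x, ENNReal.ofReal ((2:ℝ)^((k:ℝ) * s)) * ‖LPop φ₀ k g x‖ₑ
          * ‖𝓕⁻ freqBump x‖ₑ := Finset.sum_le_sum fun k _ => hterm k
    _ = ∫⁻ x, (∑ k ∈ A, ENNReal.ofReal ((2:ℝ)^((k:ℝ) * s)) * ‖LPop φ₀ k g x‖ₑ)
          * ‖𝓕⁻ freqBump x‖ₑ := by
        simp_rw [Finset.sum_mul]
        rw [lintegral_finsetSum]
        exact fun k _ => ((hmeas k).const_mul _).mul hζc.enorm.measurable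
    _ ≤ ∫⁻ x, ENNReal.ofReal ((A.card : ℝ)^(1 - 1/q)) * (S x ^ (1/q) * ‖𝓕⁻ freqBump x‖ₑ) := by
        refine lintegral_mono fun x => ?_
        rw [← mul_assoc]
        gcongr
        exact hpt x
    _ = ENNReal.ofReal ((A.card : ℝ)^(1 - 1/q)) * ∫⁻ x, S x ^ (1/q) * ‖𝓕⁻ freqBump x‖ₑ :=
        lintegral_const_mul' _ _ ENNReal.ofReal_ne_top
    _ ≤ ENNReal.ofReal ((A.card : ℝ)^(1 - 1/q)) *
          ((∫⁻ x, (S x ^ (1/q)) ^ p) ^ (1/p) * Zₑ) := by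
        gcongr
        exact ENNReal.lintegral_mul_le_Lp_mul_Lq volume hpc (hSm.pow_const _).aemeasurable
          hζc.enorm.measurable.aemeasurable
    _ = ENNReal.ofReal ((A.card : ℝ)^(1 - 1/q)) * (FNorm φ₀ p q s g * Zₑ) := by
        simp_rw [← ENNReal.rpow_mul, one_div_mul_eq_div]
        rfl
    _ ≤ ENNReal.ofReal ((A.card : ℝ)^(1 - 1/q)) *
          (FNorm φ₀ p q s g * ENNReal.ofReal (Zₑ.toReal + 1)) := by gcongr
    _ = _ := by
        rw [ENNReal.ofReal_mul (by positivity)]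
        ring

lemma exists_signs_subset {ι : Type*} [DecidableEq ι] (J : Finset ι) (B : ι → ι → ℝ) :
    ∃ (v : ι → ℝ) (V : Finset ι), (∀ i, v i = 1 ∨ v i = -1) ∧ V ⊆ J ∧
      1/2 * ∑ i ∈ J, B i i ≤ ∑ j ∈ V, ∑ i ∈ J, v i * B i j := by
  obtain ⟨v, hv, h⟩ := exists_signs_sum_diag_le J B
  have hsplit : ∑ i ∈ J, ∑ j ∈ J, v i * v j * B i j =
      (∑ j ∈ J.filter (fun j => v j = 1), ∑ i ∈ J, v i * B i j) +
        ∑ j ∈ J.filter (fun j => ¬ v j = 1), ∑ i ∈ J, -v i * B i j := by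
    rw [Finset.sum_comm, ← Finset.sum_filter_add_sum_filter_not J (fun j => v j = 1)]
    congr 1
    · refine Finset.sum_congr rfl fun j hj => Finset.sum_congr rfl fun i _ => ?_
      rw [(Finset.mem_filter.1 hj).2]; ring
    · refine Finset.sum_congr rfl fun j hj => Finset.sum_congr rfl fun i _ => ?_
      rw [(hv j).resolve_left (Finset.mem_filter.1 hj).2]; ring
  rcases le_total (∑ j ∈ J.filter (fun j => ¬ v j = 1), ∑ i ∈ J, -v i * B i j)
    (∑ j ∈ J.filter (fun j => v j = 1), ∑ i ∈ J, v i * B i j) with h1 | h1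
  · exact ⟨v, J.filter (fun j => v j = 1), hv, Finset.filter_subset _ _, by linarith⟩
  · refine ⟨fun i => -v i, J.filter (fun j => ¬ v j = 1), fun i => ?_, Finset.filter_subset _ _,
      by linarith⟩
    rcases hv i with h2 | h2 <;> simp [h2]

lemma exists_signs_level {ι : Type*} [DecidableEq ι] (J : Finset ι) (A : Finset ℕ) (κ : ι → ℕ)
    (hκ : ∀ i ∈ J, κ i ∈ A) (T : ℕ → ι → ι → ℝ) :
    ∃ (v : ι → ℝ) (σ : ℕ → ℝ) (V : Finset ι), (∀ i, v i = 1 ∨ v i = -1) ∧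
      (∀ k, σ k = 1 ∨ σ k = -1) ∧ V ⊆ J ∧
      1/2 * ∑ i ∈ J, T (κ i) i i ≤
        ∑ k ∈ A, σ k * ∑ j ∈ V, ∑ i ∈ J, σ (κ i) * v i * T k j i := by
  obtain ⟨v, V, hv, hV, h⟩ := exists_signs_subset J fun i j => T (κ i) j i
  obtain ⟨σ, hσ, h2⟩ := exists_signs_sum_diag_le A
    fun k k' => ∑ j ∈ V, ∑ i ∈ J.filter (fun i => κ i = k'), v i * T k j i
  refine ⟨v, σ, V, hv, hσ, hV, ?_⟩
  have e1 : ∑ k ∈ A, ∑ j ∈ V, ∑ i ∈ J.filter (fun i => κ i = k), v i * T k j i =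
      ∑ j ∈ V, ∑ i ∈ J, v i * T (κ i) j i := by
    rw [Finset.sum_comm]
    refine Finset.sum_congr rfl fun j _ => ?_
    rw [← Finset.sum_fiberwise_of_maps_to hκ]
    refine Finset.sum_congr rfl fun k _ => Finset.sum_congr rfl fun i hi => ?_
    rw [(Finset.mem_filter.1 hi).2]
  have e2 : ∀ k, ∑ k' ∈ A, σ k * σ k' * ∑ j ∈ V, ∑ i ∈ J.filter (fun i => κ i = k'),
      v i * T k j i = σ k * ∑ j ∈ V, ∑ i ∈ J, σ (κ i) * v i * T k j i := by
    intro k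
    simp_rw [mul_assoc (σ k), ← Finset.mul_sum]
    congr 1
    simp_rw [Finset.mul_sum]
    rw [Finset.sum_comm]
    refine Finset.sum_congr rfl fun j _ => ?_
    rw [← Finset.sum_fiberwise_of_maps_to hκ]
    refine Finset.sum_congr rfl fun k' _ => Finset.sum_congr rfl fun i hi => ?_
    rw [(Finset.mem_filter.1 hi).2, mul_assoc]
  simp_rw [e2] at h2
  rw [e1] at h2
  exact h.trans h2

lemma integrable_haarProj (E : Finset (ℕ × ℤ)) (f : ℝ → ℂ) : Integrable (haarProj E f) :=
  integrable_finsetSum _ fun e _ => (integrable_haarFn e.1 e.2).const_mul _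

lemma integrable_haarFn_mul {f : ℝ → ℂ} (hf : Integrable f) (k : ℕ) (μ : ℤ) :
    Integrable fun x => f x * haarFn k μ x :=
  hf.mul_bdd (c := 2) (measurable_haarFn k μ).aestronglyMeasurable
    (Filter.Eventually.of_forall (norm_haarFn_le k μ))

lemma integrable_testFn (k : ℕ) : Integrable (testFn k) := by
  unfold testFn
  rw [← fourierInv_toSchwartzMap (contDiff_freqBump_sub _) (hasCompactSupport_freqBump_sub _)]
  exact SchwartzMap.integrable _

lemma integral_haarProj_mul_testFn (E : Finset (ℕ × ℤ)) (f : ℝ → ℂ) (k : ℕ) :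
    ∫ x, haarProj E f x * testFn k x = ∑ e ∈ E, (2:ℂ)^e.1 *
      (∫ y, f y * haarFn e.1 e.2 y) * ∫ x, haarFn e.1 e.2 x * testFn k x := by
  simp only [haarProj, Finset.sum_mul, mul_assoc _ (haarFn _ _ _) (testFn k _)]
  rw [integral_finsetSum]
  · simp only [integral_const_mul]
  · intro e _
    refine Integrable.const_mul ?_ _
    simpa only [mul_comm] using integrable_haarFn_mul (integrable_testFn k) e.1 e.2

lemma integral_packetSum_mul_haarFn (A : Finset ℕ) (ℓ : ℕ) (s : ℝ) (ε : (Σ _ : ℕ, ℕ) → ℝ)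
    (k : ℕ) (μ : ℤ) :
    ∫ y, packetSum A ℓ s ε y * haarFn k μ y = ∑ i ∈ A.sigma (keptMids A ℓ),
      ((ε i * (2:ℝ)^(-((i.1 + ℓ : ℕ) : ℝ) * s) : ℝ) : ℂ) *
        ∫ y, packet (i.1 + ℓ) (dyadicMid i.1 i.2) y * haarFn k μ y := by
  simp only [packetSum_apply, Finset.sum_mul, mul_assoc _ (packet _ _ _) (haarFn _ _ _)]
  rw [integral_finsetSum]
  · simp only [integral_const_mul]
  · intro i _
    exact (integrable_haarFn_mul (SchwartzMap.integrable _) k μ).const_mul _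

/-- The real part of the contribution of the packet `i` and the Haar function `j` to the pairing
with the test function of frequency `2 ^ k`. -/
def haarCoeff (ℓ : ℕ) (s : ℝ) (k : ℕ) (j i : Σ _ : ℕ, ℕ) : ℝ :=
  (2:ℝ)^((k:ℝ) * s) * ((2:ℝ)^j.1 * (2:ℝ)^(-((i.1 + ℓ : ℕ) : ℝ) * s)) *
    (-Complex.I * ((∫ x, packet (i.1 + ℓ) (dyadicMid i.1 i.2) x * haarFn j.1 j.2 x) *
      ∫ x, haarFn j.1 j.2 x * testFn k x)).re

lemma le_sum_haarCoeff_diag {ℓ₀ : ℕ}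
    (hℓ₀ : ∀ t : ℝ, (2:ℝ)^ℓ₀ / 2 ≤ |t| → ‖testFn 0 t‖ ≤ 1/2) {ℓ : ℕ} (hℓ : ℓ₀ ≤ ℓ)
    {A : Finset ℕ} (hA : A.card ≤ 2^ℓ) (s : ℝ) :
    1/8 * (A.card * (2:ℝ)^((ℓ:ℝ) * (-s - 1))) ≤
      ∑ i ∈ A.sigma (keptMids A ℓ), haarCoeff ℓ s i.1 i i := by
  have hterm : ∀ k, ∀ μ ∈ keptMids A ℓ k,
      1/4 * (((2:ℝ)^k)⁻¹ * (2:ℝ)^((ℓ:ℝ) * (-s - 1))) ≤ haarCoeff ℓ s k ⟨k, μ⟩ ⟨k, μ⟩ := by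
    intro k μ hμ
    have hμ' : μ < 2^k := Finset.mem_range.1 (Finset.filter_subset _ _ hμ)
    have e : 1/4 * (((2:ℝ)^k)⁻¹ * (2:ℝ)^((ℓ:ℝ) * (-s - 1))) =
        (2:ℝ)^((k:ℝ) * s) * ((2:ℝ)^k * (2:ℝ)^(-((k + ℓ : ℕ) : ℝ) * s)) *
          (1/4 * (((2:ℝ)^(k + ℓ))⁻¹ * ((2:ℝ)^k)⁻¹)) := by
      have h2 : (0:ℝ) < 2 := by norm_num
      have e1 : (2:ℝ)^((ℓ:ℝ) * (-s - 1)) =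
          (2:ℝ)^((k:ℝ) * s) * (2:ℝ)^(-((k + ℓ : ℕ) : ℝ) * s) * ((2:ℝ)^ℓ)⁻¹ := by
        rw [← Real.rpow_natCast 2 ℓ, ← Real.rpow_neg h2.le, ← Real.rpow_add h2,
          ← Real.rpow_add h2]
        congr 1
        push_cast
        ring
      rw [e1, pow_add]
      field_simp
    rw [e]
    unfold haarCoeff
    gcongr
    exact diag_coeff_le hℓ₀ hℓ hμ'
  rw [Finset.sum_sigma, ← mul_assoc, mul_comm (1/8 : ℝ), mul_assoc, ← nsmul_eq_mul]
  refine Finset.card_nsmul_le_sum _ _ _ fun k _ => ?_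
  refine le_trans ?_ (Finset.card_nsmul_le_sum _ _ _ (hterm k))
  rw [nsmul_eq_mul]
  have hc := two_pow_le_two_mul_card_keptMids hA k
  calc 1/8 * (2:ℝ)^((ℓ:ℝ) * (-s - 1))
      = 1/8 * ((2:ℝ)^k * (((2:ℝ)^k)⁻¹ * (2:ℝ)^((ℓ:ℝ) * (-s - 1)))) := by field_simp
    _ ≤ 1/8 * (2 * (keptMids A ℓ k).card * (((2:ℝ)^k)⁻¹ * (2:ℝ)^((ℓ:ℝ) * (-s - 1)))) := by gcongr
    _ = _ := by ring

lemma exists_large_pairing {ℓ₀ : ℕ}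
    (hℓ₀ : ∀ t : ℝ, (2:ℝ)^ℓ₀ / 2 ≤ |t| → ‖testFn 0 t‖ ≤ 1/2) {ℓ : ℕ} (hℓ : ℓ₀ ≤ ℓ)
    {A : Finset ℕ} (hA : A.card ≤ 2^ℓ) (s : ℝ) :
    ∃ (ε : (Σ _ : ℕ, ℕ) → ℝ) (E : Finset (ℕ × ℤ)), (∀ i, |ε i| ≤ 1) ∧ HFset E ⊆ A ∧
      1/16 * (A.card * (2:ℝ)^((ℓ:ℝ) * (-s - 1))) ≤
        ∑ k ∈ A, (2:ℝ)^((k:ℝ) * s) *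
          ‖∫ x, haarProj E (packetSum A ℓ s ε) x * testFn k x‖ := by
  obtain ⟨v, σ, V, hv, hσ, hV, h⟩ := exists_signs_level (A.sigma (keptMids A ℓ)) A (fun i => i.1)
    (fun i hi => (Finset.mem_sigma.1 hi).1) (haarCoeff ℓ s)
  have habs : ∀ t : ℝ, t = 1 ∨ t = -1 → |t| = 1 := by rintro t (rfl | rfl) <;> simp
  refine ⟨fun i => σ i.1 * v i, V.image fun i => (i.1, (i.2 : ℤ)), fun i => ?_, ?_, ?_⟩
  · rw [abs_mul, habs _ (hσ _), habs _ (hv _), one_mul]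
  · intro k hk
    simp only [HFset, Finset.mem_image] at hk
    obtain ⟨_, ⟨i, hi, rfl⟩, rfl⟩ := hk
    exact (Finset.mem_sigma.1 (hV hi)).1
  · have hD := le_sum_haarCoeff_diag hℓ₀ hℓ hA s
    have hpair : ∀ k, ∑ j ∈ V, ∑ i ∈ A.sigma (keptMids A ℓ), σ i.1 * v i * haarCoeff ℓ s k j i =
        (2:ℝ)^((k:ℝ) * s) * (-Complex.I * ∫ x, haarProj (V.image fun i => (i.1, (i.2 : ℤ)))
          (packetSum A ℓ s fun i => σ i.1 * v i) x * testFn k x).re := by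
      intro k
      rw [integral_haarProj_mul_testFn, Finset.sum_image, Finset.mul_sum, Complex.re_sum,
        Finset.mul_sum]
      · refine Finset.sum_congr rfl fun j _ => ?_
        rw [integral_packetSum_mul_haarFn, Finset.mul_sum, Finset.sum_mul, Finset.mul_sum,
          Complex.re_sum, Finset.mul_sum]
        refine Finset.sum_congr rfl fun i _ => ?_
        have e : ∀ (a b : ℝ) (X Y : ℂ), -Complex.I * ((2:ℂ)^j.1 * (((a * b : ℝ) : ℂ) * X) * Y) =
            ((a * ((2:ℝ)^j.1 * b) : ℝ) : ℂ) * (-Complex.I * (X * Y)) := by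
          intro a b X Y
          push_cast
          ring
        rw [e, Complex.re_ofReal_mul, haarCoeff]
        ring
      · rintro ⟨a, b⟩ _ ⟨c, d⟩ _ hab
        simp only [Prod.mk.injEq, Nat.cast_inj] at hab
        obtain ⟨rfl, rfl⟩ := hab
        rfl
    simp_rw [hpair] at h
    have hle : ∀ k ∈ A, σ k * ((2:ℝ)^((k:ℝ) * s) * (-Complex.I *
        ∫ x, haarProj (V.image fun i => (i.1, (i.2 : ℤ)))
          (packetSum A ℓ s fun i => σ i.1 * v i) x * testFn k x).re) ≤ (2:ℝ)^((k:ℝ) * s) *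
        ‖∫ x, haarProj (V.image fun i => (i.1, (i.2 : ℤ)))
          (packetSum A ℓ s fun i => σ i.1 * v i) x * testFn k x‖ := by
      intro k _
      refine (le_abs_self _).trans ?_
      rw [abs_mul, habs _ (hσ k), one_mul, abs_mul, abs_of_pos (by positivity)]
      gcongr
      refine (Complex.abs_re_le_norm _).trans ?_
      rw [norm_mul, norm_neg, Complex.norm_I, one_mul]
    have := h.trans (Finset.sum_le_sum hle)
    linarith

/-- Lower bound, $1<q<p<\infty$, $-(1-1/p)<s<-(1-1/q)$: for every finite nonempty
$A\subset\mathbb N$ there are $E$ with $\mathrm{HF}(E)\subseteq A$ and a nonzero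
Schwartz $f$ with $\|P_E f\|\ge c(\#A)^{-s-1+1/q}\|f\|$. -/
theorem haar_projection_lower_bound_qp
    (p q s : ℝ) (hq : 1 < q) (hqp : q < p)
    (hs1 : -(1 - 1/p) < s) (hs2 : s < -(1 - 1/q))
    (φ₀ : ℝ → ℂ) (hφsmooth : ContDiff ℝ (⊤ : ℕ∞) φ₀) (hφcpt : HasCompactSupport φ₀)
    (hφone : ∀ ξ : ℝ, |ξ| ≤ 4/3 → φ₀ ξ = 1)
    (hφzero : ∀ ξ : ℝ, 3/2 ≤ |ξ| → φ₀ ξ = 0) :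
    ∃ c : ℝ, 0 < c ∧ ∀ (A : Finset ℕ), A.Nonempty →
      ∃ E : Finset (ℕ × ℤ), HFset E ⊆ A ∧
      ∃ f : SchwartzMap ℝ ℂ, f ≠ 0 ∧
        ENNReal.ofReal (c * ((A.card : ℝ))^(-s - 1 + 1/q)) * FNorm φ₀ p q s f ≤
          FNorm φ₀ p q s (haarProj E f) := by
  obtain ⟨ℓ₀, hℓ₀⟩ := exists_norm_testFn_zero_le
  obtain ⟨C, hC, hup⟩ := exists_FNorm_packetSum_le hφsmooth hφcpt hφone hφzero hq hqp s
  obtain ⟨Z, hZ, hlow⟩ :=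
    exists_sum_integral_testFn_le hφsmooth hφcpt hφone hφzero hq (hq.trans hqp) s
  set K : ℝ := 2 * 2^ℓ₀ with hK
  have hK0 : 0 < K := by positivity
  refine ⟨K^(-s - 1) / (16 * Z * C), by positivity, fun A hA => ?_⟩
  have hN : 1 ≤ A.card := hA.card_pos
  have hN0 : (0:ℝ) < A.card := by exact_mod_cast hN
  obtain ⟨ℓ, hℓ1, hℓ2⟩ : ∃ ℓ : ℕ, A.card * 2^ℓ₀ ≤ 2^ℓ ∧ 2^ℓ ≤ 2 * (A.card * 2^ℓ₀) := by
    have h1 : 1 ≤ A.card * 2^ℓ₀ := Nat.mul_pos hN (by positivity)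
    obtain ⟨n, hn1, hn2⟩ := exists_nat_pow_near h1 (by norm_num : 1 < 2)
    exact ⟨n + 1, hn2.le, by rw [pow_succ]; omega⟩
  have hℓ : ℓ₀ ≤ ℓ :=
    (Nat.pow_le_pow_iff_right (by norm_num)).1 ((Nat.le_mul_of_pos_left _ hN).trans hℓ1)
  have hAℓ : A.card ≤ 2^ℓ := (Nat.le_mul_of_pos_right _ (by positivity)).trans hℓ1
  obtain ⟨ε, E, hε, hE, hpair⟩ := exists_large_pairing hℓ₀ hℓ hAℓ s
  have hs : -s - 1 ≤ 0 := by
    have : 0 < 1/p := by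
      have : 0 < p := by linarith
      positivity
    linarith
  have hpow : K^(-s - 1) * (A.card : ℝ)^(-s - 1) ≤ (2:ℝ)^((ℓ:ℝ) * (-s - 1)) := by
    rw [← Real.mul_rpow hK0.le hN0.le, Real.rpow_mul (by norm_num), Real.rpow_natCast]
    refine Real.rpow_le_rpow_of_nonpos (by positivity) ?_ hs
    have : ((2^ℓ : ℕ) : ℝ) ≤ ((2 * (A.card * 2^ℓ₀) : ℕ) : ℝ) := by exact_mod_cast hℓ2
    push_cast at this
    rw [hK]
    linarith
  refine ⟨E, hE, packetSum A ℓ s ε, ?_, ?_⟩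
  · intro h0
    have hpos : 0 < 1/16 * (A.card * (2:ℝ)^((ℓ:ℝ) * (-s - 1))) := by positivity
    rw [h0] at hpair
    simp [haarProj] at hpair
    simp at hpos
    linarith
  · have h1 := hlow A _ (integrable_haarProj E (packetSum A ℓ s ε))
    set G := FNorm φ₀ p q s (haarProj E (packetSum A ℓ s ε))
    have h2 : ENNReal.ofReal ((A.card : ℝ)^(1 - 1/q) * Z) *
        (ENNReal.ofReal (K^(-s - 1) / (16 * Z * C) * (A.card : ℝ)^(-s - 1 + 1/q)) *
          ENNReal.ofReal C) ≤ ENNReal.ofReal ((A.card : ℝ)^(1 - 1/q) * Z) * G := by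
      refine le_trans ?_ h1
      rw [← ENNReal.ofReal_mul (by positivity), ← ENNReal.ofReal_mul (by positivity)]
      refine ENNReal.ofReal_le_ofReal (le_trans ?_ hpair)
      have e : (A.card : ℝ)^(1 - 1/q) * (A.card : ℝ)^(-s - 1 + 1/q) =
          A.card * (A.card : ℝ)^(-s - 1) := by
        rw [← Real.rpow_add hN0, ← Real.rpow_one_add' hN0.le]
        · congr 1; ring
        · have : 0 < 1/q := by positivity
          have : 1/q < 1 := by rw [div_lt_one (by linarith)]; exact hq
          have : s < 0 := by linarith
          linarith
      calc _ = 1/16 * (((A.card : ℝ)^(1 - 1/q) * (A.card : ℝ)^(-s - 1 + 1/q)) * K^(-s - 1)) := by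
            field_simp
        _ = 1/16 * (A.card * (K^(-s - 1) * (A.card : ℝ)^(-s - 1))) := by rw [e]; ring
        _ ≤ _ := by gcongr
    rw [ENNReal.mul_le_mul_iff_right (by simp only [ne_eq, ENNReal.ofReal_eq_zero, not_le]; positivity)
      ENNReal.ofReal_ne_top] at h2
    exact le_trans (by gcongr; exact hup A ℓ hAℓ ε hε) h2
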